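/- arXiv:2108.03276 — 3 statements merged into one kernel-verified Lean document; each statement's English description precedes it below -/
import Mathlib

section
/- Let n, k, k' ∈ ℕ₀. Then ∫_{−1}^{1} 𝖯_{k+n}^{n}(x) 𝖯_{k'+n}^{n}(x) dx = ((2n+k)! / (k! (n+k+1/2))) δ_{k,k'}, where δ_{k,k'} is the Kronecker delta. -/
/-- Pochhammer symbol `(a)_k = a (a+1) ⋯ (a+k-1)` for complex `a`. -/
noncomputable def cpoch (a : ℂ) (k : ℕ) : ℂ := ∏ i ∈ Finset.range k, (a + i)

/-- Gauss hypergeometric series `₂F₁(a, b; c; z)`. -/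
noncomputable def hyp2F1 (a b c z : ℂ) : ℂ :=
  ∑' k : ℕ, cpoch a k * cpoch b k / (cpoch c k * (Nat.factorial k : ℂ)) * z ^ k

/-- Ferrers function of the first kind `𝖯_ν^{−μ}(x)`. -/
noncomputable def ferrersP (ν μ : ℂ) (x : ℝ) : ℂ :=
  (1 / Complex.Gamma (μ + 1)) * (((1 - x) / (1 + x) : ℝ) : ℂ) ^ (μ / 2) *
    hyp2F1 (-ν) (ν + 1) (μ + 1) (((1 - x) / 2 : ℝ) : ℂ)

/-- Ferrers function of the first kind with positive integer order `𝖯_ν^{m}(x)`. -/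
noncomputable def ferrersPosP (ν : ℂ) (m : ℕ) (x : ℝ) : ℂ :=
  (-1) ^ m * (Complex.Gamma (ν + m + 1) / Complex.Gamma (ν - m + 1)) * ferrersP ν (m : ℂ) x

open Polynomial in
/-- Up to a constant, the terminating series `₂F₁(-(n+k), n+k+1; n+1; X)` as a polynomial. -/
noncomputable def ferrersPoly (n k : ℕ) : ℝ[X] :=
  ∑ j ∈ Finset.range (n + k + 1),
    C ((-1) ^ j * ((n + k).choose j : ℝ) * ((n + k + j).factorial : ℝ) / ((n + j).factorial : ℝ)) *
      X ^ j

namespace ferrersPoly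

open Polynomial

lemma natDegree_le (n k : ℕ) : (ferrersPoly n k).natDegree ≤ n + k := by
  refine natDegree_sum_le_of_forall_le _ _ fun j hj => ?_
  exact (natDegree_C_mul_X_pow_le _ _).trans (Nat.lt_succ_iff.mp (Finset.mem_range.mp hj))

lemma coeff_add (n k : ℕ) :
    (ferrersPoly n k).coeff (n + k) =
      (-1) ^ (n + k) * ((2 * (n + k)).factorial : ℝ) / ((2 * n + k).factorial : ℝ) := by
  simp only [ferrersPoly, finsetSum_coeff, coeff_C_mul_X_pow]
  rw [Finset.sum_ite_eq, if_pos (by simp), Nat.choose_self, ← two_mul,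
    show n + (n + k) = 2 * n + k by ring]
  simp

/-- Rodrigues' formula. -/
lemma X_pow_mul_eq_iterate_derivative (n k : ℕ) :
    X ^ n * ferrersPoly n k = derivative^[k] ((X * (1 - X)) ^ (n + k)) := by
  have hexp : ((X : ℝ[X]) * (1 - X)) ^ (n + k) = ∑ j ∈ Finset.range (n + k + 1),
      C ((-1) ^ j * ((n + k).choose j : ℝ)) * X ^ (n + k + j) := by
    rw [mul_pow, sub_eq_neg_add, add_pow, Finset.mul_sum]
    refine Finset.sum_congr rfl fun j _ => ?_
    rw [neg_pow (X : ℝ[X])]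
    simp only [one_pow, C_mul, C_pow, C_neg, C_1, map_natCast]
    ring
  rw [hexp, iterate_derivative_sum, ferrersPoly, Finset.mul_sum]
  refine Finset.sum_congr rfl fun j _ => ?_
  rw [iterate_derivative_C_mul, iterate_derivative_X_pow_eq_C_mul,
    show n + k + j - k = n + j by omega]
  have h : ((n + j).factorial : ℝ) * ((n + k + j).descFactorial k : ℝ) =
      ((n + k + j).factorial : ℝ) := by
    have := Nat.factorial_mul_descFactorial (n := n + k + j) (k := k) (by omega)
    rw [show n + k + j - k = n + j by omega] at this
    exact_mod_cast this
  have h0 : ((n + j).factorial : ℝ) ≠ 0 := by positivity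
  rw [← h, pow_add]
  have : (-1) ^ j * ((n + k).choose j : ℝ) *
      (((n + j).factorial : ℝ) * ((n + k + j).descFactorial k : ℝ)) / ((n + j).factorial : ℝ) =
      (-1) ^ j * ((n + k).choose j : ℝ) * ((n + k + j).descFactorial k : ℝ) := by
    field_simp
  rw [this, C_mul]
  ring

lemma one_sub_X_pow_dvd (n k : ℕ) : (1 - X) ^ n ∣ ferrersPoly n k := by
  have h : ((1 : ℝ[X]) - X) ^ n ∣ X ^ n * ferrersPoly n k := by
    rw [X_pow_mul_eq_iterate_derivative]
    have := pow_sub_dvd_iterate_derivative_of_pow_dvd k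
      (dvd_refl (((X : ℝ[X]) * (1 - X)) ^ (n + k)))
    rw [Nat.add_sub_cancel, mul_pow] at this
    exact (Dvd.intro_left _ rfl).trans this
  refine IsCoprime.dvd_of_dvd_mul_left ?_ h
  exact IsCoprime.pow ⟨1, 1, by ring⟩

/-- The quotient of `ferrersPoly n k` by `(1 - X) ^ n`, up to a constant a Jacobi polynomial. -/
noncomputable def quot (n k : ℕ) : ℝ[X] := (one_sub_X_pow_dvd n k).choose

lemma eq_mul_quot (n k : ℕ) : ferrersPoly n k = (1 - X) ^ n * quot n k :=
  (one_sub_X_pow_dvd n k).choose_spec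

lemma natDegree_one_sub_X : ((1 : ℝ[X]) - X).natDegree = 1 := by
  rw [← neg_sub, natDegree_neg, ← C_1, natDegree_X_sub_C]

lemma natDegree_quot_le (n k : ℕ) : (quot n k).natDegree ≤ k := by
  by_cases hq : quot n k = 0
  · simp [hq]
  have h1 : ((1 : ℝ[X]) - X) ≠ 0 := by
    intro h
    have := natDegree_one_sub_X
    simp [h] at this
  have := natDegree_le n k
  rw [eq_mul_quot, natDegree_mul (pow_ne_zero _ h1) hq, natDegree_pow, natDegree_one_sub_X] at this
  omega

lemma coeff_quot (n k : ℕ) :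
    (quot n k).coeff k =
      (-1) ^ k * ((2 * (n + k)).factorial : ℝ) / ((2 * n + k).factorial : ℝ) := by
  have h := coeff_add n k
  have hd : (((1 : ℝ[X]) - X) ^ n).natDegree ≤ n := by
    rw [natDegree_pow, natDegree_one_sub_X, mul_one]
  have hc : (((1 : ℝ[X]) - X) ^ n).coeff n = (-1) ^ n := by
    have := coeff_pow_of_natDegree_le (m := n) natDegree_one_sub_X.le
    rw [mul_one] at this
    simp [this, coeff_one]
  rw [eq_mul_quot, coeff_mul_add_eq_of_natDegree_le hd (natDegree_quot_le n k), hc, pow_add,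
    mul_assoc, mul_div_assoc] at h
  exact mul_left_cancel₀ (pow_ne_zero _ (by norm_num)) h

lemma iterate_derivative_quot (n k : ℕ) :
    derivative^[k] (quot n k) = C ((k.factorial : ℝ) * (quot n k).coeff k) := by
  ext m
  rw [coeff_iterate_derivative, coeff_C]
  split_ifs with hm
  · subst hm
    rw [zero_add, Nat.descFactorial_self, nsmul_eq_mul]
  · rw [coeff_eq_zero_of_natDegree_lt (lt_of_le_of_lt (natDegree_quot_le n k) (by omega)),
      smul_zero]

end ferrersPoly

namespace Polynomial

lemma integral_iterate_derivative_mul (k : ℕ) {P : ℝ[X]} (hP : (X * (1 - X)) ^ k ∣ P) (Q : ℝ[X]) :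
    ∫ t in (0 : ℝ)..1, (derivative^[k] P).eval t * Q.eval t =
      (-1) ^ k * ∫ t in (0 : ℝ)..1, P.eval t * (derivative^[k] Q).eval t := by
  induction k generalizing Q with
  | zero => simp
  | succ k ih =>
    have hd : X * (1 - X) ∣ derivative^[k] P := by
      have := pow_sub_dvd_iterate_derivative_of_pow_dvd k hP
      rwa [Nat.add_sub_cancel_left, pow_one] at this
    obtain ⟨R, hR⟩ := hd
    have hparts := intervalIntegral.integral_mul_deriv_eq_deriv_mul (a := 0) (b := 1)
      (u := fun t => Q.eval t) (v := fun t => (derivative^[k] P).eval t)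
      (u' := fun t => (derivative Q).eval t)
      (v' := fun t => (derivative (derivative^[k] P)).eval t)
      (fun x _ => Q.hasDerivAt x) (fun x _ => (derivative^[k] P).hasDerivAt x)
      ((derivative Q).continuous.intervalIntegrable _ _)
      ((derivative (derivative^[k] P)).continuous.intervalIntegrable _ _)
    have h0 : (derivative^[k] P).eval 0 = 0 := by simp [hR]
    have h1 : (derivative^[k] P).eval 1 = 0 := by simp [hR]
    simp only [h0, h1, mul_zero, sub_zero, zero_sub] at hparts
    have hih := ih ((pow_dvd_pow _ k.le_succ).trans hP) (derivative Q)
    simp only [mul_comm (eval _ Q), mul_comm (eval _ (derivative Q))] at hparts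
    rw [Function.iterate_succ_apply', hparts, hih, Function.iterate_succ_apply]
    ring

end Polynomial

lemma integral_mul_one_sub_pow (l : ℕ) :
    ∫ t in (0 : ℝ)..1, (t * (1 - t)) ^ l =
      (l.factorial : ℝ) ^ 2 / ((2 * l + 1).factorial : ℝ) := by
  have hre : 0 < ((l : ℂ) + 1).re := by
    simp only [Complex.add_re, Complex.natCast_re, Complex.one_re]
    positivity
  have h := Complex.Gamma_mul_Gamma_eq_betaIntegral hre hre
  rw [show (l : ℂ) + 1 + (l + 1) = ((2 * l + 1 : ℕ) : ℂ) + 1 by push_cast; ring,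
    Complex.Gamma_nat_eq_factorial, Complex.Gamma_nat_eq_factorial, Complex.betaIntegral] at h
  simp only [add_sub_cancel_right, Complex.cpow_natCast] at h
  have hc : ∫ x in (0 : ℝ)..1, (x : ℂ) ^ l * (1 - (x : ℂ)) ^ l =
      ((∫ t in (0 : ℝ)..1, (t * (1 - t)) ^ l : ℝ) : ℂ) := by
    rw [← intervalIntegral.integral_ofReal]
    simp [mul_pow]
  rw [hc] at h
  have h' : (l.factorial : ℝ) * l.factorial =
      ((2 * l + 1).factorial : ℝ) * ∫ t in (0 : ℝ)..1, (t * (1 - t)) ^ l := by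
    exact_mod_cast h
  rw [eq_div_iff (by positivity), sq, h', mul_comm]

open Polynomial in
lemma ferrersPoly.integral_mul_quot {n k k' : ℕ} (h : k' ≤ k) :
    ∫ t in (0 : ℝ)..1, t ^ n * (ferrersPoly n k).eval t * (quot n k').eval t =
      if k = k' then
        (k.factorial : ℝ) * ((n + k).factorial : ℝ) ^ 2 /
          (((2 * n + k).factorial : ℝ) * (2 * (n + k) + 1))
      else 0 := by
  have h1 := integral_iterate_derivative_mul k (P := (X * (1 - X)) ^ (n + k))
    (pow_dvd_pow _ (by omega)) (quot n k')
  rw [← X_pow_mul_eq_iterate_derivative] at h1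
  simp only [eval_mul, eval_pow, eval_X] at h1
  rw [h1]
  split_ifs with hk
  · subst hk
    rw [iterate_derivative_quot]
    simp only [eval_C, eval_sub, eval_one, eval_X, intervalIntegral.integral_mul_const,
      integral_mul_one_sub_pow, coeff_quot]
    have hs : ((-1 : ℝ) ^ k) * (-1) ^ k = 1 := by rw [← mul_pow]; norm_num
    rw [Nat.factorial_succ]
    push_cast
    have := Nat.factorial_ne_zero (2 * (n + k))
    field_simp
    linear_combination hs
  · rw [iterate_derivative_eq_zero (lt_of_le_of_lt (natDegree_quot_le n k') (by omega))]
    simp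

lemma cpoch_neg_natCast (l j : ℕ) :
    cpoch (-(l : ℂ)) j = (-1) ^ j * (l.descFactorial j : ℂ) := by
  induction j with
  | zero => simp [cpoch]
  | succ j ih =>
    rw [cpoch, Finset.prod_range_succ, ← cpoch, ih, Nat.descFactorial_succ]
    rcases le_or_gt j l with h | h
    · push_cast [Nat.cast_sub h]
      ring
    · simp [Nat.descFactorial_of_lt h]

lemma factorial_mul_cpoch_add_one (l j : ℕ) :
    (l.factorial : ℂ) * cpoch ((l : ℂ) + 1) j = ((l + j).factorial : ℂ) := by
  induction j with
  | zero => simp [cpoch]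
  | succ j ih =>
    rw [cpoch, Finset.prod_range_succ, ← cpoch, ← mul_assoc, ih, ← add_assoc, Nat.factorial_succ]
    push_cast
    ring

open Polynomial in
lemma hyp2F1_eq_eval_ferrersPoly (n k : ℕ) (t : ℝ) :
    hyp2F1 (-((k : ℂ) + n)) ((k : ℂ) + n + 1) ((n : ℂ) + 1) (t : ℂ) =
      (n.factorial : ℂ) / ((n + k).factorial : ℂ) * (((ferrersPoly n k).eval t : ℝ) : ℂ) := by
  have hl : (k : ℂ) + n = ((n + k : ℕ) : ℂ) := by push_cast; ring
  rw [hyp2F1, hl, tsum_eq_sum (s := Finset.range (n + k + 1))]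
  · rw [ferrersPoly, eval_finsetSum, Complex.ofReal_sum, Finset.mul_sum]
    refine Finset.sum_congr rfl fun j _ => ?_
    have h1 := factorial_mul_cpoch_add_one (n + k) j
    have h2 := factorial_mul_cpoch_add_one n j
    have hn : (n.factorial : ℂ) ≠ 0 := by exact_mod_cast n.factorial_ne_zero
    have hj : (j.factorial : ℂ) ≠ 0 := by exact_mod_cast j.factorial_ne_zero
    have hnk : ((n + k).factorial : ℂ) ≠ 0 := by exact_mod_cast (n + k).factorial_ne_zero
    have hnj : ((n + j).factorial : ℂ) ≠ 0 := by exact_mod_cast (n + j).factorial_ne_zero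
    have hc : cpoch ((n : ℂ) + 1) j ≠ 0 := by
      intro h
      rw [h, mul_zero] at h2
      exact hnj h2.symm
    rw [cpoch_neg_natCast, Nat.descFactorial_eq_factorial_mul_choose]
    simp only [eval_mul, eval_C, eval_pow, eval_X]
    push_cast
    rw [← h1, ← h2]
    push_cast
    field_simp
  · intro j hj
    rw [cpoch_neg_natCast, Nat.descFactorial_of_lt (by simpa using hj)]
    simp

lemma ferrersPosP_eq (n k : ℕ) (x : ℝ) :
    ferrersPosP ((k : ℂ) + n) n x =
      (-1) ^ n * (((2 * n + k).factorial : ℂ) / ((k.factorial : ℂ) * ((n + k).factorial : ℂ))) *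
        (((1 - x) / (1 + x) : ℝ) : ℂ) ^ ((n : ℂ) / 2) *
          (((ferrersPoly n k).eval ((1 - x) / 2) : ℝ) : ℂ) := by
  have hn : (n.factorial : ℂ) ≠ 0 := by exact_mod_cast n.factorial_ne_zero
  rw [ferrersPosP, ferrersP, hyp2F1_eq_eval_ferrersPoly,
    show (k : ℂ) + n + n + 1 = ((2 * n + k : ℕ) : ℂ) + 1 by push_cast; ring,
    show (k : ℂ) + n - n + 1 = (k : ℂ) + 1 by ring, Complex.Gamma_nat_eq_factorial,
    Complex.Gamma_nat_eq_factorial, Complex.Gamma_nat_eq_factorial]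
  field_simp

open ferrersPoly in
lemma ferrersPosP_mul_ferrersPosP (n k k' : ℕ) {x : ℝ} (hx : 1 + x ≠ 0) :
    ferrersPosP ((k : ℂ) + n) n x * ferrersPosP ((k' : ℂ) + n) n x =
      ((((2 * n + k).factorial / (k.factorial * (n + k).factorial) *
        ((2 * n + k').factorial / (k'.factorial * (n + k').factorial))) *
        (((1 - x) / 2) ^ n * (ferrersPoly n k).eval ((1 - x) / 2) *
          (quot n k').eval ((1 - x) / 2)) : ℝ) : ℂ) := by
  have hpow : (((1 - x) / (1 + x) : ℝ) : ℂ) ^ ((n : ℂ) / 2) *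
      (((1 - x) / (1 + x) : ℝ) : ℂ) ^ ((n : ℂ) / 2) = (((1 - x) / (1 + x) : ℝ) : ℂ) ^ n := by
    rw [← sq, ← Complex.cpow_nat_mul, ← Complex.cpow_natCast]
    congr 1
    push_cast
    ring
  have hquot : ((1 - x) / (1 + x)) ^ n * (ferrersPoly n k').eval ((1 - x) / 2) =
      ((1 - x) / 2) ^ n * (quot n k').eval ((1 - x) / 2) := by
    rw [eq_mul_quot]
    simp only [Polynomial.eval_mul, Polynomial.eval_pow, Polynomial.eval_sub, Polynomial.eval_one,
      Polynomial.eval_X]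
    rw [← mul_assoc, ← mul_pow]
    congr 2
    field_simp
    ring
  have hs : ((-1 : ℂ) ^ n) * (-1) ^ n = 1 := by rw [← mul_pow]; norm_num
  rw [ferrersPosP_eq, ferrersPosP_eq]
  generalize hz : (((1 - x) / (1 + x) : ℝ) : ℂ) ^ ((n : ℂ) / 2) = z at hpow ⊢
  rw [mul_assoc (((1 - x) / 2) ^ n), mul_left_comm (((1 - x) / 2) ^ n), ← hquot]
  push_cast at hpow ⊢
  rw [← hpow]
  linear_combination (((2 * n + k).factorial : ℂ) / (k.factorial * (n + k).factorial) *
    ((2 * n + k').factorial / (k'.factorial * (n + k').factorial))) * z * z *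
    (((ferrersPoly n k).eval ((1 - x) / 2) : ℝ) : ℂ) *
    (((ferrersPoly n k').eval ((1 - x) / 2) : ℝ) : ℂ) * hs

lemma ferrersPosP_orthogonality_of_le (n : ℕ) {k k' : ℕ} (h : k' ≤ k) :
    ∫ x in (-1 : ℝ)..1, ferrersPosP ((k : ℂ) + n) n x * ferrersPosP ((k' : ℂ) + n) n x =
      if k = k' then
        (Nat.factorial (2 * n + k) : ℂ) / ((Nat.factorial k : ℂ) * ((n : ℂ) + k + 1 / 2))
      else 0 := by
  have hcongr := intervalIntegral.integral_congr_ae (μ := MeasureTheory.volume)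
    (a := (-1 : ℝ)) (b := 1) (Filter.Eventually.of_forall fun x hx =>
      ferrersPosP_mul_ferrersPosP n k k' (x := x) (by
        rw [Set.uIoc_of_le (by norm_num)] at hx
        linarith [hx.1]))
  rw [hcongr, intervalIntegral.integral_ofReal, intervalIntegral.integral_const_mul]
  have hsub := intervalIntegral.integral_comp_sub_mul (a := -1) (b := 1) (c := (1 / 2 : ℝ))
    (fun t => t ^ n * (ferrersPoly n k).eval t * (ferrersPoly.quot n k').eval t) (by norm_num)
    (1 / 2)
  norm_num only [smul_eq_mul] at hsub
  rw [ferrersPoly.integral_mul_quot h] at hsub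
  have harg : ∀ x : ℝ, (1 - x) / 2 = 1 / 2 - 1 / 2 * x := fun x => by ring
  simp only [harg]
  rw [hsub]
  split_ifs with hk
  · subst hk
    have h1 : ((n : ℂ) + k + 1 / 2) ≠ 0 := by
      have : ((n : ℝ) + k + 1 / 2) ≠ 0 := by positivity
      simpa using Complex.ofReal_ne_zero.mpr this
    have h2 : (2 * ((n : ℂ) + k) + 1) ≠ 0 := by
      have : (2 * ((n : ℝ) + k) + 1) ≠ 0 := by positivity
      exact_mod_cast this
    have hk0 : (k.factorial : ℂ) ≠ 0 := by exact_mod_cast k.factorial_ne_zero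
    have hnk : ((n + k).factorial : ℂ) ≠ 0 := by exact_mod_cast (n + k).factorial_ne_zero
    have h2nk : ((2 * n + k).factorial : ℂ) ≠ 0 := by exact_mod_cast (2 * n + k).factorial_ne_zero
    push_cast
    field_simp
  · simp

theorem ferrersPosP_orthogonality (n k k' : ℕ) :
    ∫ x in (-1 : ℝ)..1, ferrersPosP ((k : ℂ) + n) n x * ferrersPosP ((k' : ℂ) + n) n x =
      if k = k' then
        (Nat.factorial (2 * n + k) : ℂ) / ((Nat.factorial k : ℂ) * ((n : ℂ) + k + 1 / 2))
      else 0 := by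
  rcases le_total k' k with h | h
  · exact ferrersPosP_orthogonality_of_le n h
  · have := ferrersPosP_orthogonality_of_le n h
    simp only [mul_comm (ferrersPosP ((k' : ℂ) + n) n _)] at this
    rw [this]
    rcases eq_or_ne k k' with rfl | hne
    · rfl
    · rw [if_neg hne, if_neg hne.symm]
end

section
/- Let n, k, k' ∈ ℕ₀ with n+k ≥ 1 and n+k' ≥ 1. Then ∫_{−1}^{1} 𝖰_{k+n−1/2}^{n−1/2}(x) 𝖰_{k'+n−1/2}^{n−1/2}(x) dx = (π² (2n+k−1)! / (4 (n+k) k!)) δ_{k,k'}, where δ_{k,k'} is the Kronecker delta. -/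
/-- Ferrers function of the second kind `𝖰_ν^μ(x)`. -/
noncomputable def ferrersQ (ν μ : ℂ) (x : ℝ) : ℂ :=
  ((Real.pi : ℂ) / (2 * Complex.sin ((Real.pi : ℂ) * μ))) *
    (Complex.cos ((Real.pi : ℂ) * μ) / Complex.Gamma (1 - μ) *
        (((1 + x) / (1 - x) : ℝ) : ℂ) ^ (μ / 2) *
        hyp2F1 (-ν) (ν + 1) (1 - μ) (((1 - x) / 2 : ℝ) : ℂ)
      - Complex.Gamma (ν + μ + 1) / (Complex.Gamma (ν - μ + 1) * Complex.Gamma (1 + μ)) *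
        (((1 - x) / (1 + x) : ℝ) : ℂ) ^ (μ / 2) *
        hyp2F1 (-ν) (ν + 1) (1 + μ) (((1 - x) / 2 : ℝ) : ℂ))

theorem cpoch_zero (a : ℂ) : cpoch a 0 = 1 := by simp [cpoch]

theorem cpoch_succ (a : ℂ) (m : ℕ) : cpoch a (m + 1) = cpoch a m * (a + m) := by
  simp [cpoch, Finset.prod_range_succ]

theorem cpoch_succ_left (a : ℂ) (m : ℕ) : cpoch a (m + 1) = a * cpoch (a + 1) m := by
  simp only [cpoch, Finset.prod_range_succ']
  push_cast
  simp only [add_zero, add_assoc, add_comm (1 : ℂ)]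
  ring

theorem cpoch_ne_zero {a : ℂ} (ha : ∀ m : ℕ, a + m ≠ 0) (m : ℕ) : cpoch a m ≠ 0 :=
  Finset.prod_ne_zero_iff.mpr fun i _ => ha i

theorem add_natCast_ne_zero {a : ℂ} (ha : 0 < a.re) (m : ℕ) : a + m ≠ 0 := by
  intro h
  have := congrArg Complex.re h
  simp only [Complex.add_re, Complex.natCast_re, Complex.zero_re] at this
  have : (0 : ℝ) ≤ m := m.cast_nonneg
  linarith

theorem Gamma_add_natCast {a : ℂ} (ha : 0 < a.re) (m : ℕ) :
    Complex.Gamma (a + m) = cpoch a m * Complex.Gamma a := by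
  induction m with
  | zero => simp [cpoch_zero]
  | succ m ih =>
    rw [cpoch_succ, Nat.cast_succ, ← add_assoc, Complex.Gamma_add_one _ (add_natCast_ne_zero ha m),
      ih]
    ring

theorem cpoch_neg_natCast_of_lt {k m : ℕ} (h : k < m) : cpoch (-k : ℂ) m = 0 :=
  Finset.prod_eq_zero (Finset.mem_range.mpr h) (by simp)

theorem cpoch_neg_natCast_s12 (k i : ℕ) :
    cpoch (-k : ℂ) i = (-1) ^ i * (k.choose i : ℂ) * (i.factorial : ℂ) := by
  induction i with
  | zero => simp [cpoch_zero]
  | succ i ih =>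
    have h := congrArg (Nat.cast : ℕ → ℂ) (Nat.choose_succ_right_eq k i)
    rw [cpoch_succ, ih, Nat.factorial_succ]
    rcases le_or_gt i k with hik | hik
    · push_cast [Nat.cast_sub hik] at h ⊢
      linear_combination (-(-1) ^ (i + 1) * (i.factorial : ℂ)) * h
    · simp [Nat.choose_eq_zero_of_lt hik, Nat.choose_eq_zero_of_lt (Nat.lt_succ_of_lt hik)]

/-- Coefficients of the Gauss hypergeometric series. -/
noncomputable def hypCoeff (a b c : ℂ) (m : ℕ) : ℂ :=
  cpoch a m * cpoch b m / (cpoch c m * (m.factorial : ℂ))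

theorem hypCoeff_succ {a b c : ℂ} (hc : ∀ m : ℕ, c + m ≠ 0) (m : ℕ) :
    (m + 1) * (c + m) * hypCoeff a b c (m + 1) = (a + m) * (b + m) * hypCoeff a b c m := by
  have h1 := cpoch_ne_zero hc m
  have h2 := hc m
  have h3 : (m.factorial : ℂ) ≠ 0 := by exact_mod_cast m.factorial_ne_zero
  have h4 : (m + 1 : ℂ) ≠ 0 := by exact_mod_cast m.succ_ne_zero
  simp only [hypCoeff, cpoch_succ, Nat.factorial_succ]
  push_cast
  field_simp

open PowerSeries in
theorem coeff_hypergeometric_operator (a b c : ℂ) (y : PowerSeries ℂ) (m : ℕ) :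
    coeff m (X * (1 - X) * derivative ℂ (derivative ℂ y)
      + (C c - C (a + b + 1) * X) * derivative ℂ y - C (a * b) * y) =
    (m + 1) * (c + m) * coeff (m + 1) y - (a + m) * (b + m) * coeff m y := by
  obtain ⟨d, hd⟩ : ∃ d, d = a + b + 1 := ⟨_, rfl⟩
  obtain ⟨e, he⟩ : ∃ e, e = a * b := ⟨_, rfl⟩
  rw [← hd, ← he]
  have h : X * (1 - X) * derivative ℂ (derivative ℂ y)
      + (C c - C d * X) * derivative ℂ y - C e * y
      = X * derivative ℂ (derivative ℂ y) - X * (X * derivative ℂ (derivative ℂ y))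
        + C c * derivative ℂ y - C d * (X * derivative ℂ y) - C e * y := by ring
  rw [h]
  rcases m with _ | _ | m
  all_goals
    simp only [map_sub, map_add, coeff_C_mul, coeff_zero_X_mul, coeff_derivative, coeff_succ_X_mul]
    rw [hd, he]
    push_cast
    ring

open PowerSeries in
theorem mk_hypCoeff_ode {a b c : ℂ} (hc : ∀ m : ℕ, c + m ≠ 0) :
    X * (1 - X) * derivative ℂ (derivative ℂ (PowerSeries.mk (hypCoeff a b c)))
      + (C c - C (a + b + 1) * X) * derivative ℂ (PowerSeries.mk (hypCoeff a b c))
      - C (a * b) * PowerSeries.mk (hypCoeff a b c) = 0 := by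
  ext m
  rw [coeff_hypergeometric_operator]
  simp [hypCoeff_succ hc]

open PowerSeries in
theorem coeff_eq_hypCoeff_of_ode {a b c : ℂ} (hc : ∀ m : ℕ, c + m ≠ 0) {y : PowerSeries ℂ}
    (h0 : coeff 0 y = 1)
    (hy : X * (1 - X) * derivative ℂ (derivative ℂ y)
      + (C c - C (a + b + 1) * X) * derivative ℂ y - C (a * b) * y = 0) (m : ℕ) :
    coeff m y = hypCoeff a b c m := by
  induction m with
  | zero => rw [h0]; simp [hypCoeff, cpoch_zero]
  | succ m ih =>
    have h := congrArg (coeff m) hy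
    rw [coeff_hypergeometric_operator, ih, ← hypCoeff_succ hc, map_zero, ← mul_sub] at h
    have h4 : (m + 1 : ℂ) ≠ 0 := by exact_mod_cast m.succ_ne_zero
    rcases mul_eq_zero.mp h with h | h
    · exact absurd h (mul_ne_zero h4 (hc m))
    · exact sub_eq_zero.mp h

open PowerSeries in
theorem mk_binomial_ode (a : ℂ) :
    (1 - X) * derivative ℂ (PowerSeries.mk fun m => cpoch a m / (m.factorial : ℂ)) =
      C a * PowerSeries.mk fun m => cpoch a m / (m.factorial : ℂ) := by
  ext m
  rw [sub_mul, one_mul]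
  rcases m with _ | m
  · simp only [map_sub, coeff_derivative, coeff_mk, coeff_zero_X_mul, coeff_C_mul, cpoch_succ,
      Nat.factorial_succ]
    simp [cpoch_zero]
  · have h3 : (m.factorial : ℂ) ≠ 0 := by exact_mod_cast m.factorial_ne_zero
    have h4 : (m + 1 : ℂ) ≠ 0 := by exact_mod_cast m.succ_ne_zero
    have h5 : (m + 1 + 1 : ℂ) ≠ 0 := by exact_mod_cast (m + 1).succ_ne_zero
    simp only [map_sub, coeff_derivative, coeff_mk, coeff_succ_X_mul, coeff_C_mul, cpoch_succ,
      Nat.factorial_succ]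
    push_cast
    field_simp
    ring

open PowerSeries in
/-- Euler's transformation at the level of formal power series. -/
theorem hypCoeff_euler (a b c : ℂ) (hc : ∀ m : ℕ, c + m ≠ 0) (m : ℕ) :
    ∑ p ∈ Finset.HasAntidiagonal.antidiagonal m,
      cpoch (a + b - c) p.1 / (p.1.factorial : ℂ) * hypCoeff (c - a) (c - b) c p.2 =
    hypCoeff a b c m := by
  set H : PowerSeries ℂ := PowerSeries.mk fun m => cpoch (a + b - c) m / (m.factorial : ℂ) with hH
  set P : PowerSeries ℂ := PowerSeries.mk (hypCoeff (c - a) (c - b) c) with hP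
  have e1 : (1 - X) * derivative ℂ H = C (a + b - c) * H := mk_binomial_ode _
  have e2 := congrArg (derivative ℂ) e1
  have e3 := mk_hypCoeff_ode (a := c - a) (b := c - b) hc
  rw [← hP] at e3
  simp only [Derivation.leibniz, smul_eq_mul, map_sub, Derivation.map_one_eq_zero, derivative_X,
    derivative_C] at e2
  have key : coeff m (H * P) = hypCoeff a b c m := by
    apply coeff_eq_hypCoeff_of_ode hc
    · simp [hH, hP, hypCoeff, cpoch_zero]
    · have hX : (1 - X : PowerSeries ℂ) ≠ 0 := fun h => by
        simpa using congrArg (coeff 0) h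
      refine (mul_eq_zero.mp ?_).resolve_left hX
      simp only [Derivation.leibniz, smul_eq_mul, map_add]
      simp only [map_sub, map_add, map_mul, map_one] at e1 e2 e3 ⊢
      linear_combination X * P * (1 - X) * e2
        + (X * P * (1 + (C a + C b - C c)) + 2 * X * (1 - X) * derivative ℂ P
          + (C c - (C a + C b + 1) * X) * P) * e1 + H * (1 - X) * e3
  rw [← key, coeff_mul]
  simp [hH, hP]

theorem hasSum_cpoch_div_factorial (s : ℂ) {z : ℂ} (hz : ‖z‖ < 1) :
    HasSum (fun m : ℕ => cpoch s m / (m.factorial : ℂ) * z ^ m) ((1 - z) ^ (-s)) := by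
  have hcoeff (m : ℕ) : Ring.choose (s + m - 1) m = cpoch s m / (m.factorial : ℂ) := by
    have h3 : (m.factorial : ℂ) ≠ 0 := by exact_mod_cast m.factorial_ne_zero
    rw [← Ring.multichoose_eq, eq_div_iff h3, mul_comm, ← nsmul_eq_mul,
      Ring.factorial_nsmul_multichoose_eq_ascPochhammer, Polynomial.ascPochhammer_smeval_eq_eval]
    induction m with
    | zero => simp [cpoch_zero]
    | succ m ih =>
      have h3 : (m.factorial : ℂ) ≠ 0 := by exact_mod_cast m.factorial_ne_zero
      rw [cpoch_succ, ascPochhammer_succ_eval, ih h3]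
  have h := (Complex.one_div_one_sub_cpow_hasFPowerSeriesOnBall_zero s).hasSum (y := z)
    (by simpa [enorm_eq_nnnorm, ← NNReal.coe_lt_coe] using hz)
  simpa [hcoeff, FormalMultilinearSeries.ofScalars, Complex.cpow_neg, mul_comm] using h

/-- The terminating hypergeometric sum `₂F₁(-k, a; c; z)`. -/
noncomputable def hypPoly (a c : ℂ) (k : ℕ) (z : ℂ) : ℂ :=
  ∑ i ∈ Finset.range (k + 1), hypCoeff a (-k) c i * z ^ i

theorem hypCoeff_neg_natCast_of_lt (a c : ℂ) {k i : ℕ} (h : k < i) : hypCoeff a (-k) c i = 0 := by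
  simp [hypCoeff, cpoch_neg_natCast_of_lt h]

theorem hasSum_hypPoly (a c : ℂ) (k : ℕ) (z : ℂ) :
    HasSum (fun i => hypCoeff a (-k) c i * z ^ i) (hypPoly a c k z) := by
  refine hasSum_sum_of_ne_finset_zero fun i hi => ?_
  rw [hypCoeff_neg_natCast_of_lt, zero_mul]
  simpa using hi

/-- Euler's transformation when the transformed series terminates. -/
theorem hyp2F1_eq_cpow_mul_hypPoly {a b c : ℂ} {k : ℕ} (hc : ∀ m : ℕ, c + m ≠ 0)
    (hk : c - b = -k) {z : ℂ} (hz : ‖z‖ < 1) :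
    hyp2F1 a b c z = (1 - z) ^ (c - a - b) * hypPoly (c - a) c k z := by
  have h1 := hasSum_cpoch_div_factorial (a + b - c) hz
  have h2 := hasSum_hypPoly (c - a) c k z
  have h := tsum_mul_tsum_eq_tsum_sum_antidiagonal_of_summable_norm
    h1.summable.norm h2.summable.norm
  rw [h1.tsum_eq, h2.tsum_eq] at h
  rw [show c - a - b = -(a + b - c) by ring, h, hyp2F1]
  refine tsum_congr fun m => ?_
  change hypCoeff a b c m * z ^ m = _
  rw [← hypCoeff_euler a b c hc, Finset.sum_mul, hk]
  refine Finset.sum_congr rfl fun p hp => ?_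
  rw [← Finset.HasAntidiagonal.mem_antidiagonal.mp hp, pow_add]
  ring

/-- The Chu–Vandermonde identity. -/
theorem sum_hypCoeff_eq (k : ℕ) (b c : ℂ) (hc : ∀ m : ℕ, c + m ≠ 0) :
    ∑ i ∈ Finset.range (k + 1), hypCoeff b (-k) c i = cpoch (c - b) k / cpoch c k := by
  induction k generalizing b c with
  | zero => simp [hypCoeff, cpoch_zero]
  | succ k ih =>
    have hc1 (m : ℕ) : c + 1 + m ≠ 0 := by
      have := hc (m + 1)
      push_cast at this
      rwa [add_assoc, add_comm (1 : ℂ)]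
    have hc0 : c ≠ 0 := by simpa using hc 0
    have step (i : ℕ) : hypCoeff b (-(k + 1 : ℕ)) c (i + 1) =
        hypCoeff b (-k) c (i + 1) - b / c * hypCoeff (b + 1) (-k) (c + 1) i := by
      have e1 := cpoch_ne_zero hc1 i
      have e3 : (i.factorial : ℂ) ≠ 0 := by exact_mod_cast i.factorial_ne_zero
      have e4 : (i + 1 : ℂ) ≠ 0 := by exact_mod_cast i.succ_ne_zero
      simp only [hypCoeff, cpoch_neg_natCast_s12, cpoch_succ_left b, cpoch_succ_left c,
        Nat.choose_succ_succ', Nat.factorial_succ]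
      push_cast
      field_simp
      ring
    have h0 : hypCoeff b (-(k + 1 : ℕ)) c 0 = hypCoeff b (-k) c 0 := by simp [hypCoeff, cpoch_zero]
    rw [Finset.sum_range_succ', Finset.sum_congr rfl fun i _ => step i, Finset.sum_sub_distrib,
      ← Finset.mul_sum, ih _ _ hc1, h0, sub_add_eq_add_sub,
      ← Finset.sum_range_succ' (fun i => hypCoeff b (-k) c i), Finset.sum_range_succ,
      ih _ _ hc, hypCoeff_neg_natCast_of_lt _ _ (Nat.lt_succ_self k), cpoch_succ (c - b)]
    have e1 := cpoch_ne_zero hc1 k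
    have e2 := cpoch_ne_zero hc k
    have e3 : cpoch c k * (c + k) = c * cpoch (c + 1) k := by rw [← cpoch_succ, cpoch_succ_left]
    rw [cpoch_succ_left c, show c + 1 - (b + 1) = c - b by ring, add_zero]
    have e4 : 1 / cpoch c k = (c + k) / (c * cpoch (c + 1) k) := by
      rw [← e3]; have := hc k; field_simp
    rw [div_eq_mul_one_div _ (cpoch c k), e4]
    field_simp
    ring

/-- Moments of the Jacobi weight `(z (1 - z))^(c - 1)`. -/
theorem integral_weight_mul_pow {c : ℂ} (hc : 0 < c.re) (i j : ℕ) :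
    IntervalIntegrable (fun z : ℝ => (z : ℂ) ^ (c - 1) * (1 - (z : ℂ)) ^ (c - 1) *
      ((z : ℂ) ^ i * (1 - (z : ℂ)) ^ j)) MeasureTheory.volume 0 1 ∧
    ∫ z in (0 : ℝ)..1, (z : ℂ) ^ (c - 1) * (1 - (z : ℂ)) ^ (c - 1) *
      ((z : ℂ) ^ i * (1 - (z : ℂ)) ^ j) =
      Complex.Gamma c * Complex.Gamma (c + j) / Complex.Gamma (2 * c + j) *
        (cpoch c i / cpoch (2 * c + j) i) := by
  have hre (m : ℕ) : 0 < (c + m).re := by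
    have : (0 : ℝ) ≤ m := m.cast_nonneg
    simp only [Complex.add_re, Complex.natCast_re]
    linarith
  have hre2 : 0 < (2 * c + j).re := by
    have := hre j
    simp only [Complex.add_re, Complex.natCast_re, Complex.mul_re, Complex.re_ofNat,
      Complex.im_ofNat] at this ⊢
    linarith
  have heq : Set.EqOn (fun z : ℝ => (z : ℂ) ^ (c + i - 1) * (1 - (z : ℂ)) ^ (c + j - 1))
      (fun z : ℝ => (z : ℂ) ^ (c - 1) * (1 - (z : ℂ)) ^ (c - 1) *
        ((z : ℂ) ^ i * (1 - (z : ℂ)) ^ j)) (Set.Ioo 0 1) := by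
    intro z hz
    have h1 : (z : ℂ) ≠ 0 := by exact_mod_cast hz.1.ne'
    have h2 : 1 - (z : ℂ) ≠ 0 := sub_ne_zero.mpr (by exact_mod_cast hz.2.ne')
    simp only
    rw [show c + i - 1 = c - 1 + i by ring, show c + j - 1 = c - 1 + j by ring,
      Complex.cpow_add _ _ h1, Complex.cpow_add _ _ h2, Complex.cpow_natCast,
      Complex.cpow_natCast]
    ring
  constructor
  · refine (Complex.betaIntegral_convergent (hre i) (hre j)).congr_uIoo ?_
    rwa [Set.uIoo_of_le zero_le_one]
  · rw [← intervalIntegral.integral_congr_Ioo_of_le zero_le_one heq]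
    change Complex.betaIntegral (c + i) (c + j) = _
    have h := Complex.Gamma_mul_Gamma_eq_betaIntegral (hre i) (hre j)
    rw [show c + i + (c + j) = 2 * c + j + i by ring, Gamma_add_natCast hc i,
      Gamma_add_natCast hre2 i] at h
    have e1 := cpoch_ne_zero (add_natCast_ne_zero hre2) i
    have e2 := Complex.Gamma_ne_zero_of_re_pos hre2
    rw [div_mul_div_comm, eq_div_iff (mul_ne_zero e2 e1)]
    linear_combination -h

theorem intervalIntegrable_weight_mul {c : ℂ} (hc : 0 < c.re) {f : ℝ → ℂ} (hf : Continuous f) :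
    IntervalIntegrable (fun z : ℝ => (z : ℂ) ^ (c - 1) * (1 - (z : ℂ)) ^ (c - 1) * f z)
      MeasureTheory.volume 0 1 := by
  have h := (integral_weight_mul_pow hc 0 0).1
  simp only [pow_zero, mul_one] at h
  exact h.mul_continuousOn hf.continuousOn

theorem integral_weight_mul_sum {c : ℂ} (hc : 0 < c.re) (s : Finset ℕ) (a : ℕ → ℂ)
    {f : ℕ → ℝ → ℂ} (hf : ∀ i, Continuous (f i)) :
    ∫ z in (0 : ℝ)..1, (z : ℂ) ^ (c - 1) * (1 - (z : ℂ)) ^ (c - 1) * ∑ i ∈ s, a i * f i z =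
      ∑ i ∈ s, a i *
        ∫ z in (0 : ℝ)..1, (z : ℂ) ^ (c - 1) * (1 - (z : ℂ)) ^ (c - 1) * f i z := by
  simp only [← intervalIntegral.integral_const_mul]
  rw [← intervalIntegral.integral_finsetSum
    fun i _ => (intervalIntegrable_weight_mul hc (hf i)).const_mul (a i)]
  simp only [Finset.mul_sum, mul_left_comm]

theorem continuous_hypPoly (a c : ℂ) (k : ℕ) : Continuous fun z : ℝ => hypPoly a c k (z : ℂ) := by
  unfold hypPoly
  fun_prop

theorem integral_weight_mul_one_sub_pow_mul_hypPoly {c : ℂ} (hc : 0 < c.re) (k j : ℕ) :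
    ∫ z in (0 : ℝ)..1, (z : ℂ) ^ (c - 1) * (1 - (z : ℂ)) ^ (c - 1) *
      ((1 - (z : ℂ)) ^ j * hypPoly (2 * c + k - 1) c k z) =
      Complex.Gamma c * Complex.Gamma (c + j) / Complex.Gamma (2 * c + j) *
        (cpoch (j + 1 - k) k / cpoch (2 * c + j) k) := by
  have hre2 : 0 < (2 * c + j).re := by
    have : (0 : ℝ) ≤ j := j.cast_nonneg
    simp only [Complex.add_re, Complex.natCast_re, Complex.mul_re, Complex.re_ofNat,
      Complex.im_ofNat]
    linarith
  have h := integral_weight_mul_sum hc (Finset.range (k + 1)) (hypCoeff (2 * c + k - 1) (-k) c)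
    (f := fun i z => (z : ℂ) ^ i * (1 - (z : ℂ)) ^ j) (fun i => by fun_prop)
  have e (z : ℝ) : (1 - (z : ℂ)) ^ j * hypPoly (2 * c + k - 1) c k z =
      ∑ i ∈ Finset.range (k + 1), hypCoeff (2 * c + k - 1) (-k) c i *
        ((z : ℂ) ^ i * (1 - (z : ℂ)) ^ j) := by
    rw [hypPoly, Finset.mul_sum]
    exact Finset.sum_congr rfl fun i _ => by ring
  simp only [e]
  have hv := sum_hypCoeff_eq k (2 * c + k - 1) (2 * c + j) (add_natCast_ne_zero hre2)
  rw [show 2 * c + j - (2 * c + k - 1) = j + 1 - k by ring] at hv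
  rw [h, ← hv, Finset.mul_sum]
  refine Finset.sum_congr rfl fun i _ => ?_
  rw [(integral_weight_mul_pow hc i j).2]
  have e1 := cpoch_ne_zero (add_natCast_ne_zero hc) i
  simp only [hypCoeff]
  field_simp

theorem cpoch_add_one_sub (k j : ℕ) (h : j ≤ k) :
    cpoch (j + 1 - k) k = if j = k then (k.factorial : ℂ) else 0 := by
  split_ifs with hjk
  · subst hjk
    rw [show (j : ℂ) + 1 - j = 1 by ring]
    clear h
    induction j with
    | zero => simp [cpoch_zero]
    | succ j ih => rw [cpoch_succ, ih, Nat.factorial_succ]; push_cast; ring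
  · have hlt : j < k := lt_of_le_of_ne h hjk
    refine Finset.prod_eq_zero (i := k - 1 - j) (Finset.mem_range.mpr (by omega)) ?_
    rw [Nat.sub_sub, Nat.cast_sub (by omega)]
    push_cast
    ring

theorem integral_weight_mul_pow_mul_hypPoly {c : ℂ} (hc : 0 < c.re) {k i : ℕ} (hi : i ≤ k) :
    ∫ z in (0 : ℝ)..1, (z : ℂ) ^ (c - 1) * (1 - (z : ℂ)) ^ (c - 1) *
      ((z : ℂ) ^ i * hypPoly (2 * c + k - 1) c k z) =
      if i = k then (-1) ^ k * (Complex.Gamma c * Complex.Gamma (c + k) /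
        Complex.Gamma (2 * c + k) * ((k.factorial : ℂ) / cpoch (2 * c + k) k)) else 0 := by
  have h := integral_weight_mul_sum hc (Finset.range (i + 1)) (fun j => (-1) ^ j * (i.choose j : ℂ))
    (f := fun j z => (1 - (z : ℂ)) ^ j * hypPoly (2 * c + k - 1) c k z)
    (fun j => Continuous.mul (by fun_prop) (continuous_hypPoly _ _ _))
  have e (z : ℝ) : (z : ℂ) ^ i * hypPoly (2 * c + k - 1) c k z =
      ∑ j ∈ Finset.range (i + 1), (-1) ^ j * (i.choose j : ℂ) *
        ((1 - (z : ℂ)) ^ j * hypPoly (2 * c + k - 1) c k z) := by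
    have hz : (z : ℂ) ^ i = (-(1 - (z : ℂ)) + 1) ^ i := by ring
    rw [hz, add_pow, Finset.sum_mul]
    refine Finset.sum_congr rfl fun j _ => ?_
    rw [neg_pow]
    ring
  simp only [e]
  rw [h]
  simp only [integral_weight_mul_one_sub_pow_mul_hypPoly hc]
  rw [Finset.sum_range_succ, Finset.sum_eq_zero, zero_add, cpoch_add_one_sub k i hi]
  · split_ifs with hik
    · simp [hik]
    · simp
  · intro j hj
    have hj := Finset.mem_range.mp hj
    rw [cpoch_add_one_sub k j (by omega), if_neg (by omega)]
    simp

theorem integral_weight_mul_hypPoly_mul_hypPoly_of_le {c : ℂ} (hc : 0 < c.re) {k k' : ℕ}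
    (hk : k' ≤ k) :
    ∫ z in (0 : ℝ)..1, (z : ℂ) ^ (c - 1) * (1 - (z : ℂ)) ^ (c - 1) *
      (hypPoly (2 * c + k' - 1) c k' z * hypPoly (2 * c + k - 1) c k z) =
      if k' = k then Complex.Gamma c ^ 2 * cpoch (2 * c + k - 1) k * (k.factorial : ℂ) /
        Complex.Gamma (2 * c + 2 * k) else 0 := by
  have h := integral_weight_mul_sum hc (Finset.range (k' + 1))
    (hypCoeff (2 * c + k' - 1) (-k') c)
    (f := fun j z => (z : ℂ) ^ j * hypPoly (2 * c + k - 1) c k z)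
    (fun j => Continuous.mul (by fun_prop) (continuous_hypPoly _ _ _))
  have e (z : ℝ) : hypPoly (2 * c + k' - 1) c k' z * hypPoly (2 * c + k - 1) c k z =
      ∑ j ∈ Finset.range (k' + 1), hypCoeff (2 * c + k' - 1) (-k') c j *
        ((z : ℂ) ^ j * hypPoly (2 * c + k - 1) c k z) := by
    rw [hypPoly, Finset.sum_mul]
    exact Finset.sum_congr rfl fun j _ => by ring
  simp only [e]
  rw [h, Finset.sum_range_succ, Finset.sum_eq_zero, zero_add,
    integral_weight_mul_pow_mul_hypPoly hc hk]
  · split_ifs with hkk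
    · subst hkk
      have hre2 : 0 < (2 * c + k').re := by
        have : (0 : ℝ) ≤ k' := k'.cast_nonneg
        simp only [Complex.add_re, Complex.natCast_re, Complex.mul_re, Complex.re_ofNat,
          Complex.im_ofNat]
        linarith
      have e1 := cpoch_ne_zero (add_natCast_ne_zero hc) k'
      have e2 := cpoch_ne_zero (add_natCast_ne_zero hre2) k'
      have e3 := Complex.Gamma_ne_zero_of_re_pos hre2
      have e4 : (k'.factorial : ℂ) ≠ 0 := by exact_mod_cast k'.factorial_ne_zero
      have e5 : ((-1 : ℂ) ^ k') ^ 2 = 1 := by rw [← pow_mul, mul_comm, pow_mul]; simp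
      rw [show 2 * c + 2 * k' = 2 * c + k' + k' by ring, Gamma_add_natCast hre2,
        Gamma_add_natCast hc, hypCoeff, cpoch_neg_natCast_s12, Nat.choose_self]
      generalize cpoch (2 * c + k') k' = q at *
      generalize Complex.Gamma (2 * c + k') = g at *
      field_simp
      rw [e5]
      simp
    · simp
  · intro j hj
    have hj := Finset.mem_range.mp hj
    rw [integral_weight_mul_pow_mul_hypPoly hc (by omega), if_neg (by omega), mul_zero]

/-- Orthogonality of the Gegenbauer polynomials in hypergeometric normalisation. -/
theorem integral_weight_mul_hypPoly_mul_hypPoly {c : ℂ} (hc : 0 < c.re) (k k' : ℕ) :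
    ∫ z in (0 : ℝ)..1, (z : ℂ) ^ (c - 1) * (1 - (z : ℂ)) ^ (c - 1) *
      (hypPoly (2 * c + k - 1) c k z * hypPoly (2 * c + k' - 1) c k' z) =
      if k = k' then Complex.Gamma c ^ 2 * cpoch (2 * c + k - 1) k * (k.factorial : ℂ) /
        Complex.Gamma (2 * c + 2 * k) else 0 := by
  rcases le_total k k' with h | h
  · rw [integral_weight_mul_hypPoly_mul_hypPoly_of_le hc h]
    split_ifs with hkk
    · rw [hkk]
    · rfl
  · simp only [mul_comm (hypPoly (2 * c + k - 1) c k _)]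
    rw [integral_weight_mul_hypPoly_mul_hypPoly_of_le hc h]
    simp only [eq_comm]

theorem cos_pi_mul_natCast_sub_half (n : ℕ) :
    Complex.cos ((Real.pi : ℂ) * ((n : ℂ) - 1 / 2)) = 0 := by
  rw [Complex.cos_eq_zero_iff]
  refine ⟨(n : ℤ) - 1, ?_⟩
  push_cast
  ring

theorem sin_pi_mul_natCast_sub_half_sq (n : ℕ) :
    Complex.sin ((Real.pi : ℂ) * ((n : ℂ) - 1 / 2)) ^ 2 = 1 := by
  have := Complex.sin_sq_add_cos_sq ((Real.pi : ℂ) * ((n : ℂ) - 1 / 2))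
  rwa [cos_pi_mul_natCast_sub_half, zero_pow two_ne_zero, add_zero] at this

theorem re_natCast_add_half_pos (n : ℕ) : 0 < ((n : ℂ) + 1 / 2).re := by
  have : (0 : ℝ) ≤ n := n.cast_nonneg
  have h : ((n : ℂ) + 1 / 2).re = n + 1 / 2 := by
    rw [show (n : ℂ) + 1 / 2 = ((n + 1 / 2 : ℝ) : ℂ) by push_cast; ring, Complex.ofReal_re]
  rw [h]
  linarith

/-- At half-integer order the Ferrers function of the second kind is a Gegenbauer function. -/
theorem ferrersQ_half_integer_order (n k : ℕ) (hk : 1 ≤ n + k) {z : ℝ}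
    (hz : z ∈ Set.Ioo (0 : ℝ) 1) :
    ferrersQ ((k : ℂ) + n - 1 / 2) ((n : ℂ) - 1 / 2) (1 - 2 * z) =
      -((Real.pi : ℂ) / (2 * Complex.sin ((Real.pi : ℂ) * ((n : ℂ) - 1 / 2)))) *
        (((2 * n + k - 1).factorial : ℂ) /
          ((k.factorial : ℂ) * Complex.Gamma ((n : ℂ) + 1 / 2))) *
        ((z / (1 - z) : ℝ) : ℂ) ^ (((n : ℂ) - 1 / 2) / 2) * (1 - (z : ℂ)) ^ ((n : ℂ) - 1 / 2) *
        hypPoly (2 * ((n : ℂ) + 1 / 2) + k - 1) ((n : ℂ) + 1 / 2) k z := by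
  have hz1 : 1 - z ≠ 0 := sub_ne_zero.mpr hz.2.ne'
  have hnorm : ‖(z : ℂ)‖ < 1 := by
    rw [Complex.norm_real, Real.norm_eq_abs, abs_of_pos hz.1]
    exact hz.2
  have hr : (1 - (1 - 2 * z)) / (1 + (1 - 2 * z)) = z / (1 - z) := by
    rw [div_eq_div_iff (by intro h; apply hz1; linarith) hz1]
    ring
  have hG : Complex.Gamma ((k : ℂ) + n - 1 / 2 + (n - 1 / 2) + 1) =
      ((2 * n + k - 1).factorial : ℂ) := by
    rw [← Complex.Gamma_nat_eq_factorial, Nat.cast_sub (by omega)]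
    push_cast
    ring_nf
  have hE := hyp2F1_eq_cpow_mul_hypPoly (a := -((k : ℂ) + n - 1 / 2)) (b := (k : ℂ) + n - 1 / 2 + 1)
    (c := (n : ℂ) + 1 / 2) (k := k) (add_natCast_ne_zero (re_natCast_add_half_pos n))
    (by ring) hnorm
  rw [ferrersQ, cos_pi_mul_natCast_sub_half, hr, hG,
    show (1 - (1 - 2 * z)) / 2 = z by ring,
    show (k : ℂ) + n - 1 / 2 - (n - 1 / 2) + 1 = k + 1 by ring, Complex.Gamma_nat_eq_factorial,
    show 1 + ((n : ℂ) - 1 / 2) = n + 1 / 2 by ring, hE,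
    show (n : ℂ) + 1 / 2 - -(k + n - 1 / 2) - (k + n - 1 / 2 + 1) = n - 1 / 2 by ring,
    show (n : ℂ) + 1 / 2 - -(k + n - 1 / 2) = 2 * (n + 1 / 2) + k - 1 by ring]
  ring

theorem cpow_half_mul_self_mul_one_sub_cpow_sq {z : ℝ} (hz : z ∈ Set.Ioo (0 : ℝ) 1) (s : ℂ) :
    (((z / (1 - z) : ℝ) : ℂ) ^ (s / 2) * (1 - (z : ℂ)) ^ s) ^ 2 =
      (z : ℂ) ^ s * (1 - (z : ℂ)) ^ s := by
  have hz1 : 0 < 1 - z := sub_pos.mpr hz.2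
  have hr : 0 < z / (1 - z) := div_pos hz.1 hz1
  have h1 : ((z / (1 - z) : ℝ) : ℂ) ^ (s / 2) * ((z / (1 - z) : ℝ) : ℂ) ^ (s / 2) =
      ((z / (1 - z) : ℝ) : ℂ) ^ s := by
    rw [← Complex.cpow_add _ _ (by exact_mod_cast hr.ne'), add_halves]
  have h2 : ((z / (1 - z) : ℝ) : ℂ) ^ s * (1 - (z : ℂ)) ^ s = (z : ℂ) ^ s := by
    have h := Complex.mul_cpow_ofReal_nonneg hr.le hz1.le s
    rw [← Complex.ofReal_mul, div_mul_cancel₀ _ hz1.ne', Complex.ofReal_sub,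
      Complex.ofReal_one] at h
    exact h.symm
  rw [← h2, ← h1]
  ring

theorem ferrersQ_orthogonality (n k k' : ℕ) (hk : 1 ≤ n + k) (hk' : 1 ≤ n + k') :
    ∫ x in (-1 : ℝ)..1,
        ferrersQ ((k : ℂ) + n - 1 / 2) ((n : ℂ) - 1 / 2) x *
          ferrersQ ((k' : ℂ) + n - 1 / 2) ((n : ℂ) - 1 / 2) x =
      if k = k' then
        (Real.pi : ℂ) ^ 2 * (Nat.factorial (2 * n + k - 1) : ℂ) /
          (4 * ((n : ℂ) + k) * (Nat.factorial k : ℂ))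
      else 0 := by
  have hc := re_natCast_add_half_pos n
  have hcov := intervalIntegral.integral_comp_sub_div (a := -1) (b := 1)
    (fun z : ℝ => ferrersQ ((k : ℂ) + n - 1 / 2) ((n : ℂ) - 1 / 2) (1 - 2 * z) *
      ferrersQ ((k' : ℂ) + n - 1 / 2) ((n : ℂ) - 1 / 2) (1 - 2 * z)) (two_ne_zero (α := ℝ)) (1 / 2)
  have hx (x : ℝ) : 1 - 2 * (1 / 2 - x / 2) = x := by ring
  simp only [hx] at hcov
  rw [hcov, show (1 / 2 - 1 / 2 : ℝ) = 0 by norm_num, show (1 / 2 - -1 / 2 : ℝ) = 1 by norm_num]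
  have hs := sin_pi_mul_natCast_sub_half_sq n
  have hcongr : Set.EqOn
      (fun z : ℝ => ferrersQ ((k : ℂ) + n - 1 / 2) ((n : ℂ) - 1 / 2) (1 - 2 * z) *
        ferrersQ ((k' : ℂ) + n - 1 / 2) ((n : ℂ) - 1 / 2) (1 - 2 * z))
      (fun z : ℝ => (Real.pi : ℂ) ^ 2 / 4 * (((2 * n + k - 1).factorial : ℂ) /
          ((k.factorial : ℂ) * Complex.Gamma ((n : ℂ) + 1 / 2))) *
          (((2 * n + k' - 1).factorial : ℂ) /
          ((k'.factorial : ℂ) * Complex.Gamma ((n : ℂ) + 1 / 2))) *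
        ((z : ℂ) ^ ((n : ℂ) + 1 / 2 - 1) * (1 - (z : ℂ)) ^ ((n : ℂ) + 1 / 2 - 1) *
          (hypPoly (2 * ((n : ℂ) + 1 / 2) + k - 1) ((n : ℂ) + 1 / 2) k z *
            hypPoly (2 * ((n : ℂ) + 1 / 2) + k' - 1) ((n : ℂ) + 1 / 2) k' z)))
      (Set.Ioo 0 1) := by
    intro z hz
    have hp : ((Real.pi : ℂ) / (2 * Complex.sin ((Real.pi : ℂ) * ((n : ℂ) - 1 / 2)))) ^ 2 =
        (Real.pi : ℂ) ^ 2 / 4 := by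
      rw [div_pow, mul_pow, hs]
      norm_num
    simp only
    rw [ferrersQ_half_integer_order n k hk hz, ferrersQ_half_integer_order n k' hk' hz,
      show (n : ℂ) + 1 / 2 - 1 = n - 1 / 2 by ring,
      ← cpow_half_mul_self_mul_one_sub_cpow_sq hz, ← hp]
    ring
  rw [intervalIntegral.integral_congr_Ioo_of_le zero_le_one hcongr,
    intervalIntegral.integral_const_mul, integral_weight_mul_hypPoly_mul_hypPoly hc]
  split_ifs with hkk
  · subst hkk
    have hre : 0 < (2 * ((n : ℂ) + 1 / 2) + k - 1).re := by
      rw [show 2 * ((n : ℂ) + 1 / 2) + k - 1 = ((2 * n + k : ℕ) : ℂ) by push_cast; ring,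
        Complex.natCast_re]
      exact_mod_cast (by omega : 0 < 2 * n + k)
    have hG := Gamma_add_natCast hre k
    have e1 : Complex.Gamma (2 * ((n : ℂ) + 1 / 2) + k - 1) =
        ((2 * n + k - 1).factorial : ℂ) := by
      rw [← Complex.Gamma_nat_eq_factorial, Nat.cast_sub (by omega)]
      push_cast
      ring_nf
    have hnk : (n : ℂ) + k ≠ 0 := by exact_mod_cast (by omega : n + k ≠ 0)
    have e2 : Complex.Gamma (2 * ((n : ℂ) + 1 / 2) + 2 * k) =
        2 * (n + k) * Complex.Gamma (2 * ((n : ℂ) + 1 / 2) + k - 1 + k) := by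
      rw [show 2 * ((n : ℂ) + 1 / 2) + 2 * k = 2 * (n + k) + 1 by ring,
        Complex.Gamma_add_one _ (mul_ne_zero two_ne_zero hnk),
        show 2 * ((n : ℂ) + 1 / 2) + k - 1 + k = 2 * (n + k) by ring]
    rw [e2, hG, e1]
    have e3 := Complex.Gamma_ne_zero_of_re_pos hc
    have e4 : (k.factorial : ℂ) ≠ 0 := by exact_mod_cast k.factorial_ne_zero
    have e5 : ((2 * n + k - 1).factorial : ℂ) ≠ 0 := by
      exact_mod_cast (2 * n + k - 1).factorial_ne_zero
    have e6 := cpoch_ne_zero (add_natCast_ne_zero hre) k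
    generalize cpoch (2 * ((n : ℂ) + 1 / 2) + k - 1) k = q at *
    generalize Complex.Gamma ((n : ℂ) + 1 / 2) = g at *
    rw [Complex.real_smul]
    push_cast
    field_simp
  · simp
end

section
/- Let n ∈ ℕ₀, let μ, ν be real numbers with μ > −1, and let z be real with z > 1. Then ∫_{−1}^{1} (𝖯_{n+μ}^{−μ}(x) / (z−x)^{ν}) (1−x²)^{μ/2} dx = 2 (ν)_n 𝐐_{n+μ}^{ν−μ−1}(z) / (z²−1)^{(ν−μ−1)/2}. -/
/-- Olver's normalized associated Legendre function of the second kind `𝐐_ν^μ(z)` for real `z > 1`. -/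
noncomputable def legendreQOlver (ν μ : ℂ) (z : ℝ) : ℂ :=
  (Real.sqrt Real.pi : ℂ) * ((z ^ 2 - 1 : ℝ) : ℂ) ^ (μ / 2) /
      ((2 : ℂ) ^ (ν + 1) * Complex.Gamma (ν + 3 / 2) * (z : ℂ) ^ (ν + μ + 1)) *
    hyp2F1 ((ν + μ + 1) / 2) ((ν + μ + 2) / 2) (ν + 3 / 2) ((1 / z ^ 2 : ℝ) : ℂ)

/-- Pochhammer symbol of a real number. -/
noncomputable def rpoch (a : ℝ) (k : ℕ) : ℝ := ∏ i ∈ Finset.range k, (a + i)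

lemma rpoch_succ (a : ℝ) (k : ℕ) : rpoch a (k + 1) = rpoch a k * (a + k) :=
  Finset.prod_range_succ _ _

lemma rpoch_add (a : ℝ) (m k : ℕ) : rpoch a (m + k) = rpoch a m * rpoch (a + m) k := by
  simp only [rpoch, Finset.prod_range_add]
  congr 1
  exact Finset.prod_congr rfl fun i _ => by push_cast; ring

lemma rpoch_pos {a : ℝ} (ha : 0 < a) (k : ℕ) : 0 < rpoch a k :=
  Finset.prod_pos fun _ _ => by positivity

lemma Gamma_mul_rpoch {a : ℝ} (ha : 0 < a) (k : ℕ) :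
    Real.Gamma a * rpoch a k = Real.Gamma (a + k) := by
  induction k with
  | zero => simp [rpoch]
  | succ k ih =>
    rw [rpoch_succ, ← mul_assoc, ih, mul_comm, ← Real.Gamma_add_one (by positivity)]
    push_cast; ring_nf

lemma rpoch_eq_ascPochhammer (a : ℝ) (k : ℕ) : rpoch a k = (ascPochhammer ℝ k).eval a := by
  induction k with
  | zero => simp [rpoch]
  | succ k ih => rw [rpoch_succ, ascPochhammer_succ_eval, ih]

lemma rpoch_two_mul (a : ℝ) (m : ℕ) :
    rpoch a (2 * m) = 4 ^ m * (rpoch (a / 2) m * rpoch ((a + 1) / 2) m) := by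
  induction m with
  | zero => simp [rpoch]
  | succ m ih =>
    rw [show 2 * (m + 1) = 2 * m + 1 + 1 by ring, rpoch_succ, rpoch_succ, ih, rpoch_succ,
      rpoch_succ]
    push_cast; ring

lemma rpoch_one (k : ℕ) : rpoch 1 k = k.factorial := by
  induction k with
  | zero => simp [rpoch]
  | succ k ih => rw [rpoch_succ, ih, Nat.factorial_succ]; push_cast; ring

/-- The binomial series. -/
lemma hasSum_rpoch_one_sub_rpow (a : ℝ) {x : ℝ} (hx : |x| < 1) :
    HasSum (fun k : ℕ => rpoch a k / k.factorial * x ^ k) ((1 - x) ^ (-a)) := by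
  have h := (Real.one_div_one_sub_rpow_hasFPowerSeriesOnBall_zero a).hasSum (y := x)
    (by simpa [enorm_eq_nnnorm, ← NNReal.coe_lt_coe] using hx)
  rw [zero_add, one_div, ← Real.rpow_neg (by linarith [(abs_lt.1 hx).2])] at h
  convert! h using 2 with k
  rw [FormalMultilinearSeries.ofScalars_apply_eq, smul_eq_mul, Ring.choose_eq_smul,
    Polynomial.descPochhammer_smeval_eq_ascPochhammer, Polynomial.ascPochhammer_smeval_cast,
    Polynomial.ascPochhammer_smeval_eq_eval, rpoch_eq_ascPochhammer, smul_eq_mul]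
  rw [show a + (k : ℝ) - 1 - k + 1 = a by ring]
  ring

/-- A coefficient sequence whose power series converges absolutely on the open unit disc. -/
def UnitDiscSummable (c : ℕ → ℝ) : Prop :=
  ∀ r : ℝ, 0 < r → r < 1 → Summable fun k => |c k| * r ^ k

lemma unitDiscSummable_rpoch (a : ℝ) :
    UnitDiscSummable fun k => rpoch a k / k.factorial := by
  intro r hr hr1
  refine (hasSum_rpoch_one_sub_rpow a (x := r) (by rwa [abs_of_pos hr])).summable.abs.congr
    fun k => ?_
  rw [abs_mul, abs_of_pos (pow_pos hr k)]

lemma UnitDiscSummable.linear_mul {c : ℕ → ℝ} (h : UnitDiscSummable c) (α : ℝ) :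
    UnitDiscSummable fun k => c k * (α + k) := by
  intro r hr hr1
  set q := (1 + r) / 2 with hq
  have hq0 : 0 < q := by positivity
  have hq1 : q < 1 := by linarith
  have hrq : r < q := by linarith
  have ht : Filter.Tendsto (fun k : ℕ => (α + k) * (r / q) ^ k) Filter.atTop (nhds 0) := by
    have hlt : r / q < 1 := (div_lt_one hq0).2 hrq
    have h1 := (tendsto_pow_atTop_nhds_zero_of_lt_one (by positivity) hlt).const_mul α
    have h2 := tendsto_self_mul_const_pow_of_lt_one (r := r / q) (by positivity) hlt
    simpa [add_mul] using h1.add h2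
  refine summable_of_isBigO_nat (h q hq0 hq1) ?_
  have := (Asymptotics.isBigO_refl (fun k => c k * q ^ k) Filter.atTop).mul (ht.isBigO_one ℝ)
  refine (this.norm_left.norm_right).congr (fun k => ?_) fun k => ?_
  · simp only [norm_mul, Real.norm_eq_abs, abs_mul, abs_pow, abs_div, abs_of_pos hr,
      abs_of_pos hq0, div_pow]
    field_simp
  · simp [abs_of_pos hq0]

/-- Coefficients of the `j`-th derivative of the expansion of `(w (1 - w)) ^ s`. -/
noncomputable def rodriguesCoeff (s : ℝ) : ℕ → ℕ → ℝ
  | 0, k => rpoch (-s) k / k.factorial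
  | j + 1, k => rodriguesCoeff s j k * ((s - j) + k)

lemma rodriguesCoeff_succ (s : ℝ) (j k : ℕ) :
    rodriguesCoeff s (j + 1) k = rodriguesCoeff s j k * ((s - j) + k) := rfl

lemma unitDiscSummable_rodriguesCoeff (s : ℝ) (j : ℕ) :
    UnitDiscSummable (rodriguesCoeff s j) := by
  induction j with
  | zero => exact unitDiscSummable_rpoch _
  | succ j ih => exact ih.linear_mul _

/-- The `j`-th derivative of `(w (1 - w)) ^ s` as a generalized power series. -/
noncomputable def rodriguesSeries (s : ℝ) (j : ℕ) (w : ℝ) : ℝ :=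
  ∑' k : ℕ, rodriguesCoeff s j k * w ^ (s - j + k)

lemma hasDerivAt_rodriguesSeries (s : ℝ) (j : ℕ) {w : ℝ} (h0 : 0 < w) (h1 : w < 1) :
    HasDerivAt (rodriguesSeries s j) (rodriguesSeries s (j + 1) w) w := by
  set e := s - (j + 1 : ℕ)
  set q := (1 + w) / 2 with hq
  have hq0 : 0 < q := by positivity
  have hq1 : q < 1 := by linarith
  have hbound : ∀ y ∈ Set.Ioo (w / 2) q, y ^ e ≤ (w / 2) ^ e + 1 := by
    intro y hy
    have hy0 : 0 < y := by linarith [hy.1]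
    rcases le_total 0 e with h | h
    · have := Real.rpow_le_one hy0.le (by linarith [hy.2]) h
      have := Real.rpow_nonneg (by positivity : 0 ≤ w / 2) e
      linarith
    · have := Real.rpow_le_rpow_of_nonpos (by positivity) hy.1.le h
      linarith
  have hmem : w ∈ Set.Ioo (w / 2) q := ⟨by linarith, by linarith⟩
  refine hasDerivAt_tsum_of_isPreconnected (t := Set.Ioo (w / 2) q) (y₀ := w)
    (u := fun k => |rodriguesCoeff s (j + 1) k| * q ^ k * ((w / 2) ^ e + 1))
    (g := fun k y => rodriguesCoeff s j k * y ^ (s - j + k))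
    (g' := fun k y => rodriguesCoeff s (j + 1) k * y ^ (s - (j + 1 : ℕ) + k))
    ((unitDiscSummable_rodriguesCoeff s (j + 1) q hq0 hq1).mul_right _)
    isOpen_Ioo isPreconnected_Ioo ?_ ?_ hmem ?_ hmem
  · intro k y hy
    have hy0 : y ≠ 0 := by linarith [hy.1]
    have := (Real.hasDerivAt_rpow_const (p := s - j + k) (Or.inl hy0)).const_mul
      (rodriguesCoeff s j k)
    convert! this using 1
    rw [rodriguesCoeff_succ, show s - (j : ℝ) + k - 1 = s - (j + 1 : ℕ) + k by push_cast; ring]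
    ring
  · intro k y hy
    have hy0 : 0 < y := by linarith [hy.1]
    rw [Real.norm_eq_abs, abs_mul, Real.rpow_add hy0, Real.rpow_natCast, mul_assoc,
      abs_of_pos (mul_pos (Real.rpow_pos_of_pos hy0 _) (pow_pos hy0 k)), mul_comm (y ^ _)]
    have := hbound y hy
    have := hy.2.le
    gcongr
  · refine ((unitDiscSummable_rodriguesCoeff s j w h0 h1).of_norm_bounded (fun k => ?_) :
      Summable fun k => rodriguesCoeff s j k * w ^ k).mul_right (w ^ (s - j)) |>.congr fun k => ?_
    · simp [abs_of_pos h0]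
    · rw [Real.rpow_add h0, Real.rpow_natCast]; ring

/-- The polynomial factor of the `j`-th derivative of `(w (1 - w)) ^ s`. -/
noncomputable def rodriguesPoly (s : ℝ) : ℕ → Polynomial ℝ
  | 0 => 1
  | j + 1 => Polynomial.C (s - j) * (1 - 2 * Polynomial.X) * rodriguesPoly s j +
      Polynomial.X * (1 - Polynomial.X) * (rodriguesPoly s j).derivative

/-- The `j`-th derivative of `(w (1 - w)) ^ s` in closed form. -/
noncomputable def rodriguesFun (s : ℝ) (j : ℕ) (w : ℝ) : ℝ :=
  (w * (1 - w)) ^ (s - j) * (rodriguesPoly s j).eval w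

lemma hasDerivAt_rodriguesFun (s : ℝ) (j : ℕ) {w : ℝ} (h0 : 0 < w) (h1 : w < 1) :
    HasDerivAt (rodriguesFun s j) (rodriguesFun s (j + 1) w) w := by
  have hpos : 0 < w * (1 - w) := mul_pos h0 (by linarith)
  have hd : HasDerivAt (fun y : ℝ => y * (1 - y)) (1 - 2 * w) w := by
    convert! (hasDerivAt_id w).mul ((hasDerivAt_id w).const_sub 1) using 1
    simp; ring
  have := (hd.rpow_const (p := s - j) (Or.inl hpos.ne')).mul ((rodriguesPoly s j).hasDerivAt w)
  convert! this using 1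
  have hsplit : (w * (1 - w)) ^ (s - j) = (w * (1 - w)) ^ (s - j - 1) * (w * (1 - w)) := by
    rw [Real.rpow_sub_one hpos.ne', div_mul_cancel₀ _ hpos.ne']
  rw [rodriguesFun, rodriguesPoly, hsplit,
    show s - (j + 1 : ℕ) = s - j - 1 by push_cast; ring]
  simp
  ring

lemma rodriguesSeries_eq_rodriguesFun (s : ℝ) (j : ℕ) {w : ℝ} (h0 : 0 < w) (h1 : w < 1) :
    rodriguesSeries s j w = rodriguesFun s j w := by
  induction j generalizing w with
  | zero =>
    have h := (hasSum_rpoch_one_sub_rpow (-s) (x := w) (by rwa [abs_of_pos h0])).mul_left (w ^ s)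
    rw [neg_neg, ← Real.mul_rpow h0.le (by linarith)] at h
    rw [rodriguesFun, rodriguesSeries, rodriguesPoly]
    simp only [Nat.cast_zero, sub_zero, Polynomial.eval_one, mul_one]
    rw [← h.tsum_eq]
    refine tsum_congr fun k => ?_
    rw [rodriguesCoeff, Real.rpow_add h0, Real.rpow_natCast]; ring
  | succ j ih =>
    refine (hasDerivAt_rodriguesSeries s j h0 h1).unique
      ((hasDerivAt_rodriguesFun s j h0 h1).congr_of_eventuallyEq ?_)
    filter_upwards [Ioo_mem_nhds h0 h1] with y hy using ih hy.1 hy.2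

lemma betaIntegrand_ofReal (a : ℝ) {w : ℝ} (h0 : 0 ≤ w) (h1 : w ≤ 1) :
    (w : ℂ) ^ ((a + 1 : ℂ) - 1) * (1 - w : ℂ) ^ ((a + 1 : ℂ) - 1) =
      (((w * (1 - w)) ^ a : ℝ) : ℂ) := by
  rw [Real.mul_rpow h0 (by linarith), Complex.ofReal_mul, Complex.ofReal_cpow h0,
    Complex.ofReal_cpow (by linarith)]
  push_cast
  ring_nf

lemma intervalIntegrable_mul_one_sub_rpow {a : ℝ} (ha : -1 < a) :
    IntervalIntegrable (fun w : ℝ => (w * (1 - w)) ^ a) MeasureTheory.volume 0 1 := by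
  have hre : 0 < ((a : ℂ) + 1).re := by simp; linarith
  refine (Complex.betaIntegral_convergent hre hre).norm.congr fun w hw => ?_
  rw [Set.uIoc_of_le zero_le_one] at hw
  have hpos : 0 ≤ w * (1 - w) := mul_nonneg hw.1.le (by linarith [hw.2])
  rw [betaIntegrand_ofReal a hw.1.le hw.2, Complex.norm_real, Real.norm_eq_abs,
    abs_of_nonneg (Real.rpow_nonneg hpos a)]

lemma integral_mul_one_sub_rpow {a : ℝ} (ha : -1 < a) :
    ∫ w in (0 : ℝ)..1, (w * (1 - w)) ^ a =
      √Real.pi * Real.Gamma (a + 1) / (2 ^ (2 * a + 1) * Real.Gamma (a + 3 / 2)) := by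
  have hre : 0 < ((a : ℂ) + 1).re := by simp; linarith
  have h : ((∫ w in (0 : ℝ)..1, (w * (1 - w)) ^ a : ℝ) : ℂ) =
      Complex.betaIntegral (a + 1) (a + 1) := by
    rw [← intervalIntegral.integral_ofReal, Complex.betaIntegral]
    refine intervalIntegral.integral_congr fun w hw => ?_
    rw [Set.uIcc_of_le zero_le_one] at hw
    exact (betaIntegrand_ofReal a hw.1 hw.2).symm
  have h2 : ∫ w in (0 : ℝ)..1, (w * (1 - w)) ^ a =
      Real.Gamma (a + 1) * Real.Gamma (a + 1) / Real.Gamma (2 * (a + 1)) := by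
    rw [Complex.betaIntegral_eq_Gamma_mul_div _ _ hre hre] at h
    apply Complex.ofReal_injective
    rw [h]
    push_cast [← Complex.Gamma_ofReal]
    ring_nf
  have p1 : Real.Gamma (2 * (a + 1)) ≠ 0 := (Real.Gamma_pos_of_pos (by linarith)).ne'
  have p2 : Real.Gamma (a + 3 / 2) ≠ 0 := (Real.Gamma_pos_of_pos (by linarith)).ne'
  have p3 : (2 : ℝ) ^ (2 * a + 1) ≠ 0 := (Real.rpow_pos_of_pos two_pos _).ne'
  have hG := Real.Gamma_mul_Gamma_add_half (a + 1)
  rw [show a + 1 + 1 / 2 = a + 3 / 2 by ring,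
    show 1 - 2 * (a + 1) = -(2 * a + 1) by ring, Real.rpow_neg zero_le_two,
    mul_right_comm, ← div_eq_mul_inv, eq_div_iff p3] at hG
  rw [h2, div_eq_div_iff p1 (mul_ne_zero p3 p2)]
  linear_combination Real.Gamma (a + 1) * hG

lemma intervalIntegrable_rodriguesFun {s : ℝ} {j : ℕ} (h : -1 < s - j) :
    IntervalIntegrable (rodriguesFun s j) MeasureTheory.volume 0 1 :=
  (intervalIntegrable_mul_one_sub_rpow h).mul_continuousOn
    (rodriguesPoly s j).continuous.continuousOn

lemma continuous_rodriguesFun {s : ℝ} {j : ℕ} (h : 0 < s - j) :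
    Continuous (rodriguesFun s j) :=
  ((by fun_prop : Continuous fun w : ℝ => w * (1 - w)).rpow_const fun _ => Or.inr h.le).mul
    (rodriguesPoly s j).continuous

lemma rodriguesFun_zero_right {s : ℝ} {j : ℕ} (h : 0 < s - j) : rodriguesFun s j 0 = 0 := by
  simp [rodriguesFun, Real.zero_rpow h.ne']

lemma rodriguesFun_one_right {s : ℝ} {j : ℕ} (h : 0 < s - j) : rodriguesFun s j 1 = 0 := by
  simp [rodriguesFun, Real.zero_rpow h.ne']

lemma integral_rodriguesFun_succ_mul {s : ℝ} {j : ℕ} (h : 0 < s - j) {g g' : ℝ → ℝ}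
    (hg : ∀ w ∈ Set.Icc (0 : ℝ) 1, HasDerivAt g (g' w) w) (hg' : ContinuousOn g' (Set.Icc 0 1)) :
    ∫ w in (0 : ℝ)..1, rodriguesFun s (j + 1) w * g w =
      -∫ w in (0 : ℝ)..1, rodriguesFun s j w * g' w := by
  have hI : Set.uIcc (0 : ℝ) 1 = Set.Icc 0 1 := Set.uIcc_of_le zero_le_one
  rw [intervalIntegral.integral_mul_deriv_eq_deriv_mul_of_hasDerivAt (u' := rodriguesFun s (j + 1))
    (v := g) (continuous_rodriguesFun h).continuousOn, rodriguesFun_zero_right h,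
    rodriguesFun_one_right h]
  · simp
  · exact hI ▸ fun w hw => (hg w hw).continuousAt.continuousWithinAt
  · intro w hw
    simp only [zero_le_one, min_eq_left, max_eq_right] at hw
    exact hasDerivAt_rodriguesFun s j hw.1 hw.2
  · intro w hw
    simp only [zero_le_one, min_eq_left, max_eq_right] at hw
    exact hg w ⟨hw.1.le, hw.2.le⟩
  · exact intervalIntegrable_rodriguesFun (by push_cast; linarith)
  · exact (hI ▸ hg').intervalIntegrable

lemma integral_rodriguesFun_mul {s : ℝ} {n : ℕ} (h : -1 < s - n) {g : ℕ → ℝ → ℝ}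
    (hg : ∀ i, ∀ w ∈ Set.Icc (0 : ℝ) 1, HasDerivAt (g i) (g (i + 1) w) w) :
    ∫ w in (0 : ℝ)..1, rodriguesFun s n w * g 0 w =
      (-1) ^ n * ∫ w in (0 : ℝ)..1, rodriguesFun s 0 w * g n w := by
  induction n generalizing g with
  | zero => simp
  | succ n ih =>
    push_cast at h
    rw [integral_rodriguesFun_succ_mul (by linarith) (hg 0)
      fun w hw => (hg 1 w hw).continuousAt.continuousWithinAt,
      ih (by linarith) (g := fun i => g (i + 1)) fun i => hg (i + 1), pow_succ]
    ring

/-- Moments of `1 - 2 w` against the weight `(w (1 - w)) ^ s`. -/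
noncomputable def betaMoment (s : ℝ) (k : ℕ) : ℝ :=
  ∫ w in (0 : ℝ)..1, (w * (1 - w)) ^ s * (1 - 2 * w) ^ k

lemma betaMoment_odd (s : ℝ) (m : ℕ) : betaMoment s (2 * m + 1) = 0 := by
  have h := intervalIntegral.integral_comp_sub_left (a := (0 : ℝ)) (b := 1)
    (fun w : ℝ => (w * (1 - w)) ^ s * (1 - 2 * w) ^ (2 * m + 1)) 1
  have h2 : ∀ w : ℝ, ((1 - w) * (1 - (1 - w))) ^ s * (1 - 2 * (1 - w)) ^ (2 * m + 1) =
      -((w * (1 - w)) ^ s * (1 - 2 * w) ^ (2 * m + 1)) := fun w => by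
    rw [show 1 - 2 * (1 - w) = -(1 - 2 * w) by ring, Odd.neg_pow ⟨m, rfl⟩,
      show (1 - w) * (1 - (1 - w)) = w * (1 - w) by ring]
    ring
  simp only [h2, intervalIntegral.integral_neg, sub_self, sub_zero] at h
  rw [betaMoment]
  linarith

lemma intervalIntegrable_betaMoment {s : ℝ} (hs : -1 < s) (k : ℕ) :
    IntervalIntegrable (fun w : ℝ => (w * (1 - w)) ^ s * (1 - 2 * w) ^ k)
      MeasureTheory.volume 0 1 :=
  (intervalIntegrable_mul_one_sub_rpow hs).mul_continuousOn (by fun_prop)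

lemma betaMoment_even_succ {s : ℝ} (hs : -1 < s) (m : ℕ) :
    betaMoment s (2 * (m + 1)) * (s + 3 / 2 + m) = betaMoment s (2 * m) * (1 / 2 + m) := by
  have hd : ∀ w ∈ Set.Ioo (0 : ℝ) 1, HasDerivAt
      (fun w : ℝ => (w * (1 - w)) ^ (s + 1) * (1 - 2 * w) ^ (2 * m + 1))
      ((s + 3 / 2 + m) * ((w * (1 - w)) ^ s * (1 - 2 * w) ^ (2 * (m + 1))) -
        (1 / 2 + m) * ((w * (1 - w)) ^ s * (1 - 2 * w) ^ (2 * m))) w := by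
    intro w hw
    have hpos : 0 < w * (1 - w) := mul_pos hw.1 (by linarith [hw.2])
    have hd : HasDerivAt (fun y : ℝ => y * (1 - y)) (1 - 2 * w) w := by
      convert! (hasDerivAt_id w).mul ((hasDerivAt_id w).const_sub 1) using 1
      simp; ring
    have hl : HasDerivAt (fun y : ℝ => 1 - 2 * y) (-2) w := by
      simpa using ((hasDerivAt_id w).const_mul 2).const_sub 1
    convert! (hd.rpow_const (p := s + 1) (Or.inl hpos.ne')).mul (hl.pow (2 * m + 1)) using 1
    rw [Real.rpow_add_one hpos.ne']
    simp
    ring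
  have h := intervalIntegral.integral_eq_sub_of_hasDerivAt_of_le zero_le_one (by
      refine Continuous.continuousOn (.mul (.rpow_const (by fun_prop) fun _ => Or.inr ?_) ?_)
      · linarith
      · fun_prop) hd
    (((intervalIntegrable_betaMoment hs _).const_mul _).sub
      ((intervalIntegrable_betaMoment hs _).const_mul _))
  rw [intervalIntegral.integral_sub ((intervalIntegrable_betaMoment hs _).const_mul _)
      ((intervalIntegrable_betaMoment hs _).const_mul _), intervalIntegral.integral_const_mul,
    intervalIntegral.integral_const_mul] at h
  simp only [sub_self, mul_zero, zero_mul, Real.zero_rpow (by linarith : s + 1 ≠ 0)] at h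
  rw [betaMoment, betaMoment]
  linarith

lemma betaMoment_even {s : ℝ} (hs : -1 < s) (m : ℕ) :
    betaMoment s (2 * m) = betaMoment s 0 * (rpoch (1 / 2) m / rpoch (s + 3 / 2) m) := by
  induction m with
  | zero => simp [rpoch]
  | succ m ih =>
    have h := betaMoment_even_succ hs m
    have p1 : 0 < rpoch (s + 3 / 2) m := rpoch_pos (by linarith) m
    have p2 : 0 < s + 3 / 2 + (m : ℝ) := by have := m.cast_nonneg (α := ℝ); linarith
    rw [ih] at h
    rw [rpoch_succ, rpoch_succ, eq_div_of_mul_eq p2.ne' h]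
    field_simp

/-- The Gauss hypergeometric series with real parameters. -/
noncomputable def realHyp2F1 (a b c x : ℝ) : ℝ :=
  ∑' k : ℕ, rpoch a k * rpoch b k / (rpoch c k * k.factorial) * x ^ k

lemma integral_mul_one_sub_rpow_mul_sub_rpow {s z : ℝ} (hs : -1 < s) (hz : 1 < z) (p : ℝ) :
    ∫ w in (0 : ℝ)..1, (w * (1 - w)) ^ s * (z - (1 - 2 * w)) ^ (-p) =
      z ^ (-p) * betaMoment s 0 *
        realHyp2F1 (p / 2) ((p + 1) / 2) (s + 3 / 2) (1 / z ^ 2) := by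
  have hz0 : 0 < z := by linarith
  have hzi : |z⁻¹| < 1 := by
    rw [abs_of_pos (inv_pos.2 hz0)]; exact inv_lt_one_of_one_lt₀ hz
  have hy : ∀ w ∈ Set.uIoc (0 : ℝ) 1, |1 - 2 * w| ≤ 1 := by
    intro w hw
    rw [Set.uIoc_of_le zero_le_one] at hw
    exact abs_le.2 ⟨by linarith [hw.2], by linarith [hw.1]⟩
  set c : ℕ → ℝ := fun k => rpoch p k / k.factorial * z⁻¹ ^ k with hc
  have hcs : Summable fun k => |c k| := (hasSum_rpoch_one_sub_rpow p hzi).summable.abs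
  have hsum : HasSum (fun k => ∫ w in (0 : ℝ)..1, c k * ((w * (1 - w)) ^ s * (1 - 2 * w) ^ k))
      (∫ w in (0 : ℝ)..1, (w * (1 - w)) ^ s * (1 - z⁻¹ * (1 - 2 * w)) ^ (-p)) := by
    refine intervalIntegral.hasSum_integral_of_dominated_convergence
      (fun k w => |c k| * |(w * (1 - w)) ^ s|) (fun k => ?_) (fun k => ?_) ?_ ?_ ?_
    · exact ((intervalIntegrable_betaMoment hs k).const_mul (c k)).aestronglyMeasurable_restrict_uIoc
    · refine .of_forall fun w hw => ?_
      rw [Real.norm_eq_abs, abs_mul, abs_mul ((w * (1 - w)) ^ s), abs_pow]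
      refine mul_le_mul_of_nonneg_left ?_ (abs_nonneg (c k))
      exact mul_le_of_le_one_right (abs_nonneg _) (pow_le_one₀ (abs_nonneg _) (hy w hw))
    · exact .of_forall fun w _ => hcs.mul_right _
    · simp_rw [tsum_mul_right]
      exact (intervalIntegrable_mul_one_sub_rpow hs).abs.const_mul _
    · refine .of_forall fun w hw => ?_
      have hlt : |z⁻¹ * (1 - 2 * w)| < 1 := by
        rw [abs_mul]
        exact lt_of_le_of_lt (mul_le_of_le_one_right (abs_nonneg _) (hy w hw)) hzi
      convert! (hasSum_rpoch_one_sub_rpow p hlt).mul_left ((w * (1 - w)) ^ s) using 2 with k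
      rw [hc, mul_pow]
      ring
  simp_rw [intervalIntegral.integral_const_mul] at hsum
  change HasSum (fun k => c k * betaMoment s k) _ at hsum
  have heven := ((mul_right_injective₀ (two_ne_zero (α := ℕ))).hasSum_iff (fun k hk => by
    rcases Nat.even_or_odd' k with ⟨m, rfl | rfl⟩
    · exact absurd ⟨m, rfl⟩ hk
    · rw [betaMoment_odd, mul_zero])).2 hsum
  have hint : ∫ w in (0 : ℝ)..1, (w * (1 - w)) ^ s * (z - (1 - 2 * w)) ^ (-p) =
      z ^ (-p) * ∫ w in (0 : ℝ)..1, (w * (1 - w)) ^ s * (1 - z⁻¹ * (1 - 2 * w)) ^ (-p) := by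
    rw [← intervalIntegral.integral_const_mul]
    refine intervalIntegral.integral_congr fun w hw => ?_
    rw [Set.uIcc_of_le zero_le_one] at hw
    have h1 : 0 ≤ 1 - z⁻¹ * (1 - 2 * w) := by
      have : 0 < z⁻¹ := inv_pos.2 hz0
      have : z⁻¹ < 1 := inv_lt_one_of_one_lt₀ hz
      nlinarith [hw.1]
    have h2 : z - (1 - 2 * w) = z * (1 - z⁻¹ * (1 - 2 * w)) := by field_simp
    rw [h2, Real.mul_rpow hz0.le h1]
    ring
  rw [hint, ← heven.tsum_eq, mul_assoc, realHyp2F1]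
  congr 1
  rw [← tsum_mul_left]
  refine tsum_congr fun m => ?_
  have hfac := rpoch_two_mul 1 m
  rw [rpoch_one, show ((1 : ℝ) + 1) / 2 = 1 by norm_num, rpoch_one] at hfac
  have p1 : 0 < rpoch (s + 3 / 2) m := rpoch_pos (by linarith) m
  have p2 : 0 < rpoch (1 / 2) m := rpoch_pos (by norm_num) m
  simp only [Function.comp_apply, hc]
  rw [betaMoment_even hs, rpoch_two_mul, hfac, pow_mul, inv_pow, one_div (z ^ 2)]
  field_simp

lemma rpoch_succ_left (a : ℝ) (k : ℕ) : rpoch a (k + 1) = a * rpoch (a + 1) k := by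
  rw [add_comm, rpoch_add]
  simp [rpoch]

lemma rodriguesCoeff_eq (s : ℝ) (j k : ℕ) :
    rodriguesCoeff s j k = rpoch (-s) k / k.factorial * rpoch (s - j + k + 1) j := by
  induction j with
  | zero => simp [rodriguesCoeff, rpoch]
  | succ j ih =>
    rw [rodriguesCoeff_succ, ih, rpoch_succ_left]
    push_cast
    rw [show s - (j + 1) + k + 1 = s - j + k by ring]
    ring

/-- A Rodrigues formula for the hypergeometric function in the Ferrers function. -/
lemma rodriguesFun_eq_realHyp2F1 {μ : ℝ} (hμ : -1 < μ) (n : ℕ) {w : ℝ} (h0 : 0 < w) (h1 : w < 1) :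
    rodriguesFun (n + μ) n w =
      rpoch (μ + 1) n * w ^ μ * realHyp2F1 (-(n + μ)) (n + μ + 1) (μ + 1) w := by
  rw [← rodriguesSeries_eq_rodriguesFun _ _ h0 h1, rodriguesSeries, realHyp2F1, ← tsum_mul_left]
  refine tsum_congr fun k => ?_
  have p : 0 < rpoch (μ + 1) k := rpoch_pos (by linarith) k
  have h := rpoch_add (μ + 1) k n
  rw [add_comm k n, rpoch_add, show μ + 1 + (n : ℝ) = n + μ + 1 by ring,
    show μ + 1 + (k : ℝ) = μ + k + 1 by ring] at h
  rw [rodriguesCoeff_eq, show (n : ℝ) + μ - n = μ by ring, Real.rpow_add h0, Real.rpow_natCast]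
  field_simp
  linear_combination (-1) * rpoch (-(n + μ)) k * h

lemma cpoch_ofReal (a : ℝ) (k : ℕ) : cpoch (a : ℂ) k = (rpoch a k : ℂ) := by
  simp [cpoch, rpoch]

lemma hyp2F1_ofReal (a b c x : ℝ) :
    hyp2F1 (a : ℂ) (b : ℂ) (c : ℂ) (x : ℂ) = (realHyp2F1 a b c x : ℂ) := by
  rw [hyp2F1, realHyp2F1, Complex.ofReal_tsum]
  refine tsum_congr fun k => ?_
  simp only [cpoch_ofReal]
  push_cast
  rfl

lemma ferrersP_mul_ofReal (ν μ : ℝ) {x : ℝ} (h0 : -1 < x) (h1 : x < 1) :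
    ferrersP (ν : ℂ) (μ : ℂ) x * ((1 - x ^ 2 : ℝ) : ℂ) ^ ((μ : ℂ) / 2) =
      (((1 - x) ^ μ / Real.Gamma (μ + 1) *
        realHyp2F1 (-ν) (ν + 1) (μ + 1) ((1 - x) / 2) : ℝ) : ℂ) := by
  have hp : 0 < 1 + x := by linarith
  have hm : 0 < 1 - x := by linarith
  have h := hyp2F1_ofReal (-ν) (ν + 1) (μ + 1) ((1 - x) / 2)
  have hpow : (1 - x) ^ μ = ((1 - x) / (1 + x)) ^ (μ / 2) * (1 - x ^ 2) ^ (μ / 2) := by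
    rw [← Real.mul_rpow (by positivity) (by nlinarith),
      show (1 - x) / (1 + x) * (1 - x ^ 2) = (1 - x) ^ 2 by field_simp; ring,
      ← Real.rpow_natCast, ← Real.rpow_mul hm.le]
    congr 1
    push_cast
    ring
  have e1 := Complex.ofReal_cpow (by positivity : 0 ≤ (1 - x) / (1 + x)) (μ / 2)
  have e2 := Complex.ofReal_cpow (by nlinarith : 0 ≤ 1 - x ^ 2) (μ / 2)
  rw [Complex.ofReal_div μ, Complex.ofReal_ofNat] at e1 e2
  rw [ferrersP, ← e1, ← e2, hpow, Complex.ofReal_mul, ← h]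
  push_cast [← Complex.Gamma_ofReal]
  ring

lemma legendreQOlver_div_ofReal (a b : ℝ) {z : ℝ} (hz : 1 < z) :
    legendreQOlver (a : ℂ) (b : ℂ) z / ((z ^ 2 - 1 : ℝ) : ℂ) ^ ((b : ℂ) / 2) =
      ((√Real.pi / (2 ^ (a + 1) * Real.Gamma (a + 3 / 2) * z ^ (a + b + 1)) *
        realHyp2F1 ((a + b + 1) / 2) ((a + b + 2) / 2) (a + 3 / 2) (1 / z ^ 2) : ℝ) : ℂ) := by
  have h := hyp2F1_ofReal ((a + b + 1) / 2) ((a + b + 2) / 2) (a + 3 / 2) (1 / z ^ 2)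
  have hne : ((z ^ 2 - 1 : ℝ) : ℂ) ^ ((b : ℂ) / 2) ≠ 0 := by
    rw [Ne, Complex.cpow_eq_zero_iff, Complex.ofReal_eq_zero]
    rintro ⟨h, -⟩
    nlinarith
  rw [legendreQOlver, Complex.ofReal_mul, ← h]
  push_cast [Complex.ofReal_cpow (by linarith : 0 ≤ z), Complex.ofReal_cpow zero_le_two,
    ← Complex.Gamma_ofReal] at hne ⊢
  field_simp

lemma integral_rodriguesFun_mul_sub_rpow {s z : ℝ} {n : ℕ} (hs : -1 < s - n) (hz : 1 < z)
    (ν : ℝ) :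
    ∫ w in (0 : ℝ)..1, rodriguesFun s n w * (z - (1 - 2 * w)) ^ (-ν) =
      2 ^ n * rpoch ν n * z ^ (-(ν + n)) * betaMoment s 0 *
        realHyp2F1 ((ν + n) / 2) ((ν + n + 1) / 2) (s + 3 / 2) (1 / z ^ 2) := by
  have h := integral_rodriguesFun_mul hs (g := fun i w =>
    (-2) ^ i * rpoch ν i * (z - (1 - 2 * w)) ^ (-(ν + i))) (fun i w hw => by
      have hpos : 0 < z - (1 - 2 * w) := by linarith [hw.1]
      have hl : HasDerivAt (fun y : ℝ => z - (1 - 2 * y)) 2 w := by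
        simpa using (((hasDerivAt_id w).const_mul 2).const_sub 1).const_sub z
      convert! (hl.rpow_const (p := -(ν + i)) (Or.inl hpos.ne')).const_mul
        ((-2) ^ i * rpoch ν i) using 1
      rw [rpoch_succ, show -(ν + (i + 1 : ℕ)) = -(ν + i) - 1 by push_cast; ring]
      ring)
  have hn := n.cast_nonneg (α := ℝ)
  have h2 := integral_mul_one_sub_rpow_mul_sub_rpow (s := s) (by linarith) hz (ν + n)
  have h3 : ∀ w : ℝ, rodriguesFun s 0 w * ((-2) ^ n * rpoch ν n * (z - (1 - 2 * w)) ^ (-(ν + n))) =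
      (-2) ^ n * rpoch ν n * ((w * (1 - w)) ^ s * (z - (1 - 2 * w)) ^ (-(ν + n))) := fun w => by
    simp [rodriguesFun, rodriguesPoly]; ring
  simp only [h3, intervalIntegral.integral_const_mul, h2] at h
  simp only [pow_zero, one_mul, rpoch, Finset.range_zero, Finset.prod_empty, Nat.cast_zero,
    add_zero] at h
  rw [h, rpoch, show (2 : ℝ) ^ n = (-1) ^ n * (-2) ^ n by rw [← mul_pow]; norm_num]
  ring

theorem ferrersP_integral_legendreQOlver (n : ℕ) (μ ν : ℝ) (hμ : -1 < μ)
    (z : ℝ) (hz : 1 < z) :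
    ∫ x in (-1 : ℝ)..1,
        ferrersP ((n : ℂ) + μ) (μ : ℂ) x / ((z - x : ℝ) : ℂ) ^ (ν : ℂ) *
          ((1 - x ^ 2 : ℝ) : ℂ) ^ ((μ : ℂ) / 2) =
      2 * cpoch (ν : ℂ) n * legendreQOlver ((n : ℂ) + μ) ((ν : ℂ) - μ - 1) z /
        ((z ^ 2 - 1 : ℝ) : ℂ) ^ (((ν : ℂ) - μ - 1) / 2) := by
  have hn := n.cast_nonneg (α := ℝ)
  have hc : (n : ℂ) + μ = ((n + μ : ℝ) : ℂ) := by push_cast; rfl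
  have hb : (ν : ℂ) - μ - 1 = ((ν - μ - 1 : ℝ) : ℂ) := by push_cast; rfl
  have hleft : ∫ x in (-1 : ℝ)..1,
        ferrersP ((n : ℂ) + μ) (μ : ℂ) x / ((z - x : ℝ) : ℂ) ^ (ν : ℂ) *
          ((1 - x ^ 2 : ℝ) : ℂ) ^ ((μ : ℂ) / 2) =
      ∫ x in (-1 : ℝ)..1, ((2 ^ μ / Real.Gamma (n + μ + 1) *
        (rodriguesFun (n + μ) n (1 / 2 - x / 2) *
          (z - (1 - 2 * (1 / 2 - x / 2))) ^ (-ν)) : ℝ) : ℂ) := by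
    refine intervalIntegral.integral_congr_Ioo_of_le (by norm_num) fun x hx => ?_
    have hm : 0 < 1 - x := by linarith [hx.2]
    have hzx : 0 < z - x := by linarith [hx.2]
    have hg := Gamma_mul_rpoch (by linarith : 0 < μ + 1) n
    have pg : Real.Gamma (μ + 1) ≠ 0 := (Real.Gamma_pos_of_pos (by linarith)).ne'
    have pp : rpoch (μ + 1) n ≠ 0 := (rpoch_pos (by linarith) n).ne'
    rw [div_mul_eq_mul_div, hc, ferrersP_mul_ofReal _ _ hx.1 hx.2, ← Complex.ofReal_cpow hzx.le,
      ← Complex.ofReal_div, show (1 : ℝ) / 2 - x / 2 = (1 - x) / 2 by ring,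
      rodriguesFun_eq_realHyp2F1 hμ n (by linarith) (by linarith [hx.1]),
      show (n : ℝ) + μ + 1 = μ + 1 + n by ring, ← hg, Real.div_rpow hm.le zero_le_two,
      show z - (1 - 2 * ((1 - x) / 2)) = z - x by ring, Real.rpow_neg hzx.le]
    congr 1
    field_simp
  have p1 : Real.Gamma (n + μ + 1) ≠ 0 := (Real.Gamma_pos_of_pos (by linarith)).ne'
  have p2 : Real.Gamma (n + μ + 3 / 2) ≠ 0 := (Real.Gamma_pos_of_pos (by linarith)).ne'
  have hM : betaMoment (n + μ) 0 = √Real.pi * Real.Gamma (n + μ + 1) /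
      (2 ^ (2 * (n + μ) + 1) * Real.Gamma (n + μ + 3 / 2)) := by
    rw [← integral_mul_one_sub_rpow (by linarith), betaMoment]
    simp
  have h2 : (2 : ℝ) ^ (2 * (n + μ) + 1) = 2 ^ μ * 2 ^ n * 2 ^ (n + μ + 1) := by
    rw [← Real.rpow_natCast, ← Real.rpow_add two_pos, ← Real.rpow_add two_pos]
    ring_nf
  have q1 : (2 : ℝ) ^ μ ≠ 0 := (Real.rpow_pos_of_pos two_pos _).ne'
  rw [hleft, intervalIntegral.integral_ofReal, intervalIntegral.integral_const_mul,
    intervalIntegral.integral_comp_sub_div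
      (fun w => rodriguesFun (n + μ) n w * (z - (1 - 2 * w)) ^ (-ν)) two_ne_zero,
    show (1 : ℝ) / 2 - 1 / 2 = 0 by norm_num, show (1 : ℝ) / 2 - -1 / 2 = 1 by norm_num,
    integral_rodriguesFun_mul_sub_rpow (by linarith) hz, mul_div_assoc, hc, hb,
    legendreQOlver_div_ofReal _ _ hz, cpoch_ofReal, hM, h2, smul_eq_mul]
  norm_cast
  push_cast
  rw [show (n : ℝ) + μ + (ν - μ - 1) + 1 = ν + n by ring,
    show (n : ℝ) + μ + (ν - μ - 1) + 2 = ν + n + 1 by ring, Real.rpow_neg (by linarith)]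
  field_simp
end
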